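/- arXiv:1602.04318 — 5 statements merged into one kernel-verified Lean document; each statement's English description precedes it below -/
import Mathlib

section
/- Let N ≥ 3. There exists a constant C > 0, depending only on N, α and c₀, such that for every smooth compactly supported function u : ℝ^N → ℝ vanishing on ℝ^N ∖ Ω one has (∫_Ω |u(x)|^{q*} a(x) dx)^{1/q*} ≤ C (∫_Ω |∇u(x)|² dx)^{1/2}, where q* = 2(N−α)/(N−2) > 2. -/
open MeasureTheory Real

section EuclideanSpace

variable {N : ℕ}

/-- The derivative of a differentiable function vanishes almost everywhere on its zero set. -/
theorem ae_restrict_fderiv_eq_zero_of_forall_eq_zero (hN : 0 < N)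
    {u : EuclideanSpace ℝ (Fin N) → ℝ} (hu : Differentiable ℝ u) {s : Set (EuclideanSpace ℝ (Fin N))}
    (hs : MeasurableSet s) (h0 : ∀ x ∈ s, u x = 0) :
    ∀ᵐ x ∂(volume.restrict s), fderiv ℝ u x = 0 := by
  set e : EuclideanSpace ℝ (Fin N) := EuclideanSpace.single (⟨0, hN⟩ : Fin N) (1 : ℝ)
  have he : ‖e‖ = 1 := by simp [e]
  have happrox : ApproximatesLinearOn (fun x => u x • e)
      (0 : EuclideanSpace ℝ (Fin N) →L[ℝ] EuclideanSpace ℝ (Fin N)) s 0 := by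
    intro x hx y hy
    simp [h0 x hx, h0 y hy]
  have h := happrox.norm_fderiv_sub_le volume hs (fun x => (fderiv ℝ u x).smulRight e)
    (fun x _ => ((hu x).hasFDerivAt.smul_const e).hasFDerivWithinAt)
  filter_upwards [h] with x hx
  have hnorm : ‖(fderiv ℝ u x).smulRight e‖₊ = 0 := by simpa using hx
  have : ‖(fderiv ℝ u x).smulRight e‖ = 0 := by simpa using hnorm
  rw [ContinuousLinearMap.norm_smulRight_apply, he, mul_one] at this
  exact norm_eq_zero.1 this

/-- Integration by parts against the Euler vector field. -/
theorem integral_fderiv_apply_self {w : EuclideanSpace ℝ (Fin N) → ℝ} (hw : ContDiff ℝ 1 w)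
    (hc : HasCompactSupport w) :
    ∫ x, fderiv ℝ w x x = -(N * ∫ x, w x) := by
  have hcd := hw.continuous_fderiv one_ne_zero
  have hcoord (i : Fin N) : HasCompactSupport
      (fun x : EuclideanSpace ℝ (Fin N) => x i * fderiv ℝ w x (EuclideanSpace.single i 1)) :=
    (hc.fderiv_apply ℝ _).mul_left
  have hint (i : Fin N) : Integrable
      (fun x : EuclideanSpace ℝ (Fin N) => x i * fderiv ℝ w x (EuclideanSpace.single i 1)) :=
    Continuous.integrable_of_hasCompactSupport (by fun_prop) (hcoord i)
  have hproj (i : Fin N) (x : EuclideanSpace ℝ (Fin N)) :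
      fderiv ℝ (fun y : EuclideanSpace ℝ (Fin N) => y i) x (EuclideanSpace.single i 1) = 1 := by
    have : (fun y : EuclideanSpace ℝ (Fin N) => y i) = EuclideanSpace.proj (𝕜 := ℝ) i := rfl
    rw [this, ContinuousLinearMap.fderiv]
    simp
  have hparts (i : Fin N) :
      ∫ x : EuclideanSpace ℝ (Fin N), x i * fderiv ℝ w x (EuclideanSpace.single i 1) = -∫ x, w x := by
    rw [integral_mul_fderiv_eq_neg_fderiv_mul_of_integrable]
    · simp [hproj]
    · simpa [hproj] using hw.continuous.integrable_of_hasCompactSupport hc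
    · exact hint i
    · exact Continuous.integrable_of_hasCompactSupport (by fun_prop) hc.mul_left
    · intro x _; fun_prop
    · intro x _; exact hw.differentiable one_ne_zero x
  have hsum (x : EuclideanSpace ℝ (Fin N)) :
      fderiv ℝ w x x = ∑ i, x i * fderiv ℝ w x (EuclideanSpace.single i 1) := by
    conv_lhs => enter [2]; rw [← (EuclideanSpace.basisFun (Fin N) ℝ).sum_repr x]
    simp
  simp_rw [hsum]
  rw [integral_finsetSum _ fun i _ => hint i]
  simp [hparts]

theorem contDiff_sq_div_norm_sq {u : EuclideanSpace ℝ (Fin N) → ℝ} (hu : ContDiff ℝ 1 u)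
    (h0 : ∀ᶠ x in nhds 0, u x = 0) : ContDiff ℝ 1 (fun x => u x ^ 2 / ‖x‖ ^ 2) := by
  rw [contDiff_iff_contDiffAt]
  intro x
  by_cases hx : x = 0
  · subst hx
    refine (contDiffAt_const (c := (0 : ℝ))).congr_of_eventuallyEq ?_
    filter_upwards [h0] with x hx
    simp [hx]
  · exact (hu.pow 2).contDiffAt.div (contDiff_norm_sq ℝ).contDiffAt (by simpa using hx)

/-- **Hardy's inequality** for functions vanishing near the origin, with a non-optimal constant. -/
theorem integral_sq_div_norm_sq_le (hN : 3 ≤ N) {u : EuclideanSpace ℝ (Fin N) → ℝ}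
    (hu : ContDiff ℝ 1 u) (hc : HasCompactSupport u) (h0 : ∀ᶠ x in nhds 0, u x = 0) :
    ∫ x, u x ^ 2 / ‖x‖ ^ 2 ≤ 4 * ∫ x, ‖fderiv ℝ u x‖ ^ 2 := by
  set w : EuclideanSpace ℝ (Fin N) → ℝ := fun x => u x ^ 2 / ‖x‖ ^ 2 with hw_def
  have hw : ContDiff ℝ 1 w := contDiff_sq_div_norm_sq hu h0
  have hwc : HasCompactSupport w := hc.mono fun x hx => by
    contrapose! hx
    simp_all [w]
  have hcdu := hu.continuous_fderiv one_ne_zero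
  have hcdw := hw.continuous_fderiv one_ne_zero
  have hwi : Integrable w := hw.continuous.integrable_of_hasCompactSupport hwc
  have hDi : Integrable (fun x => ‖fderiv ℝ u x‖ ^ 2) :=
    Continuous.integrable_of_hasCompactSupport (by fun_prop)
      ((hc.fderiv ℝ).comp_left (g := fun L => ‖L‖ ^ 2) (by simp))
  have hEi : Integrable (fun x => fderiv ℝ w x x) := by
    refine Continuous.integrable_of_hasCompactSupport (by fun_prop) ((hwc.fderiv ℝ).mono ?_)
    intro x hx
    contrapose! hx
    simp_all
  have hu0 : u 0 = 0 := h0.self_of_nhds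
  have hprod : (fun x => w x * ‖x‖ ^ 2) = fun x => u x ^ 2 := by
    funext x
    by_cases hx : x = 0
    · simp [hx, hu0]
    · have : ‖x‖ ≠ 0 := by simpa using hx
      simp only [w]
      field_simp
  have hpt (x : EuclideanSpace ℝ (Fin N)) : -fderiv ℝ w x x ≤ 5 / 2 * w x + 2 * ‖fderiv ℝ u x‖ ^ 2 := by
    by_cases hx : x = 0
    · subst hx
      simp only [map_zero, neg_zero]
      positivity
    have hx' : 0 < ‖x‖ := by simpa using hx
    have h1 : HasFDerivAt (fun x => w x * ‖x‖ ^ 2) _ x :=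
      (hw.differentiable one_ne_zero x).hasFDerivAt.mul
        (hasStrictFDerivAt_norm_sq x).hasFDerivAt
    have h2 : HasFDerivAt (fun x => u x ^ 2) _ x :=
      (hu.differentiable one_ne_zero x).hasFDerivAt.pow 2
    rw [hprod] at h1
    have h3 := DFunLike.congr_fun (h1.unique h2) x
    simp at h3
    have hle : |fderiv ℝ u x x| ≤ ‖fderiv ℝ u x‖ * ‖x‖ := (fderiv ℝ u x).le_opNorm x
    have hux : u x ^ 2 = w x * ‖x‖ ^ 2 := (congrFun hprod x).symm
    have hmul : -fderiv ℝ w x x * ‖x‖ ^ 2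
        ≤ (5 / 2 * w x + 2 * ‖fderiv ℝ u x‖ ^ 2) * ‖x‖ ^ 2 := by
      have hsq : (fderiv ℝ u x x) ^ 2 ≤ (‖fderiv ℝ u x‖ * ‖x‖) ^ 2 :=
        sq_le_sq' (abs_le.1 hle).1 (abs_le.1 hle).2
      nlinarith [sq_nonneg (u x + 2 * fderiv ℝ u x x)]
    exact le_of_mul_le_mul_right hmul (by positivity)
  have hmain := integral_mono hEi.neg ((hwi.const_mul (5 / 2)).add (hDi.const_mul 2)) hpt
  simp only [Pi.neg_apply, Pi.add_apply] at hmain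
  rw [integral_neg, integral_fderiv_apply_self hw hwc,
    integral_add (hwi.const_mul _) (hDi.const_mul _), integral_const_mul,
    integral_const_mul] at hmain
  have hN' : (3 : ℝ) ≤ N := by exact_mod_cast hN
  have hw0 : 0 ≤ ∫ x, w x := integral_nonneg fun x => by positivity
  nlinarith

/-- The Sobolev inequality with gradient in `L²`, in terms of Bochner integrals. -/
theorem exists_integral_rpow_le_integral_fderiv_sq (hN : 3 ≤ N) {p : ℝ}
    (hp : p = 2 * N / (N - 2)) :
    ∃ S : ℝ, 0 < S ∧ ∀ u : EuclideanSpace ℝ (Fin N) → ℝ, ContDiff ℝ 1 u → HasCompactSupport u →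
      ∫ x, |u x| ^ p ≤ S * (∫ x, ‖fderiv ℝ u x‖ ^ 2) ^ (p / 2) := by
  have hN' : (3 : ℝ) ≤ N := by exact_mod_cast hN
  have hp0 : 0 < p := by
    rw [hp]
    exact div_pos (by linarith) (by linarith)
  set K :=
    SNormLESNormFDerivOfEqConst ℝ (volume : Measure (EuclideanSpace ℝ (Fin N))) ((2 : NNReal) : ℝ) with hK
  refine ⟨((K : ℝ) + 1) ^ p, by positivity, fun u hu hc => ?_⟩
  lift p to NNReal using hp0.le
  have h := eLpNorm_le_eLpNorm_fderiv_of_eq (volume : Measure (EuclideanSpace ℝ (Fin N))) hu hc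
    (p := 2) (p' := p) (by norm_num) (by simp; omega) (by
      rw [hp, finrank_euclideanSpace_fin]
      have : (N : ℝ) - 2 ≠ 0 := by linarith
      push_cast
      field_simp)
  have hp0' : (p : ENNReal) ≠ 0 := by
    simpa using hp0.ne'
  rw [(hu.continuous.memLp_of_hasCompactSupport hc).eLpNorm_eq_integral_rpow_norm hp0'
      ENNReal.coe_ne_top,
    ((hu.continuous_fderiv one_ne_zero).memLp_of_hasCompactSupport
      (hc.fderiv ℝ)).eLpNorm_eq_integral_rpow_norm (by simp) ENNReal.coe_ne_top,
    ← hK, ← ENNReal.ofReal_coe_nnreal (p := K), ← ENNReal.ofReal_mul (by positivity),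
    ENNReal.ofReal_le_ofReal_iff (by positivity)] at h
  simp only [ENNReal.coe_toReal, Real.norm_eq_abs, NNReal.coe_ofNat, Real.rpow_ofNat] at h
  have hA : 0 ≤ ∫ x, |u x| ^ (p : ℝ) := integral_nonneg fun x => by positivity
  have hB : 0 ≤ ∫ x, ‖fderiv ℝ u x‖ ^ 2 := integral_nonneg fun x => by positivity
  have h' : (∫ x, |u x| ^ (p : ℝ)) ^ (p : ℝ)⁻¹
      ≤ ((K : ℝ) + 1) * (∫ x, ‖fderiv ℝ u x‖ ^ 2) ^ (2 : ℝ)⁻¹ := by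
    refine h.trans ?_
    gcongr
    linarith
  calc ∫ x, |u x| ^ (p : ℝ) = ((∫ x, |u x| ^ (p : ℝ)) ^ (p : ℝ)⁻¹) ^ (p : ℝ) :=
        (Real.rpow_inv_rpow hA hp0.ne').symm
    _ ≤ (((K : ℝ) + 1) * (∫ x, ‖fderiv ℝ u x‖ ^ 2) ^ (2 : ℝ)⁻¹) ^ (p : ℝ) := by gcongr
    _ = _ := by
        rw [Real.mul_rpow (by positivity) (by positivity), ← Real.rpow_mul hB]
        congr 2
        ring

end EuclideanSpace

/-- Hölder's inequality with weights `s + t = 1`, allowing `s = 0` or `t = 0`. -/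
theorem integral_rpow_mul_rpow_le {X : Type*} [MeasurableSpace X] {μ : Measure X} {f g : X → ℝ}
    (hf : Integrable f μ) (hg : Integrable g μ) (hf0 : ∀ x, 0 ≤ f x) (hg0 : ∀ x, 0 ≤ g x)
    {s t : ℝ} (hs : 0 ≤ s) (ht : 0 ≤ t) (hst : s + t = 1) :
    Integrable (fun x => f x ^ s * g x ^ t) μ ∧
      ∫ x, f x ^ s * g x ^ t ∂μ ≤ (∫ x, f x ∂μ) ^ s * (∫ x, g x ∂μ) ^ t := by
  have hF : 0 ≤ ∫ x, f x ∂μ := integral_nonneg hf0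
  have hG : 0 ≤ ∫ x, g x ∂μ := integral_nonneg hg0
  have hnn (x : X) : 0 ≤ f x ^ s * g x ^ t :=
    mul_nonneg (Real.rpow_nonneg (hf0 x) s) (Real.rpow_nonneg (hg0 x) t)
  have hmeas : AEStronglyMeasurable (fun x => f x ^ s * g x ^ t) μ :=
    ((hf.aemeasurable.pow_const s).mul (hg.aemeasurable.pow_const t)).aestronglyMeasurable
  have h : ∫⁻ x, ENNReal.ofReal (f x ^ s * g x ^ t) ∂μ
      ≤ ENNReal.ofReal ((∫ x, f x ∂μ) ^ s * (∫ x, g x ∂μ) ^ t) := by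
    have h1 := ENNReal.lintegral_mul_norm_pow_le hf.aemeasurable.ennreal_ofReal
      hg.aemeasurable.ennreal_ofReal hs ht hst
    rw [← ofReal_integral_eq_lintegral_ofReal hf (.of_forall hf0),
      ← ofReal_integral_eq_lintegral_ofReal hg (.of_forall hg0),
      ENNReal.ofReal_rpow_of_nonneg hF hs, ENNReal.ofReal_rpow_of_nonneg hG ht,
      ← ENNReal.ofReal_mul (by positivity)] at h1
    refine le_trans (le_of_eq ?_) h1
    refine lintegral_congr fun x => ?_
    rw [ENNReal.ofReal_rpow_of_nonneg (hf0 x) hs, ENNReal.ofReal_rpow_of_nonneg (hg0 x) ht,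
      ← ENNReal.ofReal_mul (Real.rpow_nonneg (hf0 x) s)]
  have hint : Integrable (fun x => f x ^ s * g x ^ t) μ := by
    refine ⟨hmeas, ?_⟩
    rw [hasFiniteIntegral_iff_ofReal (.of_forall hnn)]
    exact h.trans_lt ENNReal.ofReal_lt_top
  refine ⟨hint, ?_⟩
  rw [← ofReal_integral_eq_lintegral_ofReal hint (.of_forall hnn)] at h
  exact (ENNReal.ofReal_le_ofReal_iff (by positivity)).1 h

/-- Hardy–Sobolev interpolation at the level of integrands. -/
theorem rpow_mul_rpow_neg_eq {v r α p q : ℝ} (hv : 0 ≤ v) (hr : 0 ≤ r) (hα : 0 ≤ α)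
    (hαq : α < q) (hpq : p * (1 - α / 2) = q - α) :
    v ^ q * r ^ (-α) = (v ^ 2 / r ^ 2) ^ (α / 2) * (v ^ p) ^ (1 - α / 2) := by
  rw [← Real.rpow_mul hv, hpq, Real.div_rpow (by positivity) (by positivity),
    ← Real.rpow_natCast_mul hv, ← Real.rpow_natCast_mul hr, Real.rpow_neg hr]
  have h2 : ((2 : ℕ) : ℝ) * (α / 2) = α := by push_cast; ring
  rw [h2]
  have hq : v ^ q = v ^ α * v ^ (q - α) := by
    rw [← Real.rpow_add_of_nonneg hv hα (by linarith)]
    congr 1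
    ring
  rw [hq]
  ring

/-- **Weighted Sobolev embedding (Lemma 2.5, case `N ≥ 3`).**
There exists `C > 0` depending only on `N`, `α`, `c₀` such that for every exterior
domain `Ω` with `0 ∉ closure Ω`, every weight `a` with
`c₀ |x|^(-α) ≤ a x ≤ c₀⁻¹ |x|^(-α)` on `closure Ω`, and every smooth compactly
supported `u` vanishing outside `Ω`, one has
`‖u‖_{L^{q*}(a dx)} ≤ C ‖∇u‖_{L²}` with `q* = 2(N-α)/(N-2)`. -/
theorem stmt0 (N : ℕ) (hN : 3 ≤ N) (α c₀ : ℝ) (hα : 0 ≤ α ∧ α < 1)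
    (hc₀ : 0 < c₀ ∧ c₀ < 1) (q : ℝ) (hq : q = 2 * ((N : ℝ) - α) / ((N : ℝ) - 2)) :
    ∃ C : ℝ, 0 < C ∧
      ∀ (Ω : Set (EuclideanSpace ℝ (Fin N))), IsOpen Ω →
        (0 : EuclideanSpace ℝ (Fin N)) ∉ closure Ω →
      ∀ a : EuclideanSpace ℝ (Fin N) → ℝ,
        (∀ x ∈ closure Ω, c₀ * ‖x‖ ^ (-α) ≤ a x ∧ a x ≤ c₀⁻¹ * ‖x‖ ^ (-α)) →
      ∀ u : EuclideanSpace ℝ (Fin N) → ℝ, ContDiff ℝ (⊤ : ℕ∞) u → HasCompactSupport u →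
        (∀ x ∉ Ω, u x = 0) →
        (∫ x in Ω, |u x| ^ q * a x) ^ q⁻¹
          ≤ C * (∫ x in Ω, ‖fderiv ℝ u x‖ ^ 2) ^ ((1 : ℝ) / 2) := by
  have hN' : (3 : ℝ) ≤ N := by exact_mod_cast hN
  obtain ⟨hα0, hα1⟩ := hα
  have hN2 : 0 < (N : ℝ) - 2 := by linarith
  obtain ⟨p, hp⟩ : ∃ p : ℝ, p = 2 * N / (N - 2) := ⟨_, rfl⟩
  have hp0 : 0 < p := by rw [hp]; positivity
  have hpq : p * (1 - α / 2) = q - α := by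
    rw [hp, hq]
    field_simp
    ring
  have hαq : α < q := by nlinarith
  have hq0 : 0 < q := hα0.trans_lt hαq
  have hexp : α / 2 + p / 2 * (1 - α / 2) = q / 2 := by linarith
  obtain ⟨S, hS, hSob⟩ := exists_integral_rpow_le_integral_fderiv_sq hN hp
  obtain ⟨K, hK⟩ : ∃ K : ℝ, K = c₀⁻¹ * (4 ^ (α / 2) * S ^ (1 - α / 2)) := ⟨_, rfl⟩
  have hc₀' := hc₀.1
  have hK0 : 0 < K := by rw [hK]; positivity
  refine ⟨K ^ q⁻¹, by positivity, fun Ω hΩ h0Ω a ha u hu hc huΩ => ?_⟩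
  have hu1 : ContDiff ℝ 1 u := hu.of_le (by exact_mod_cast le_top)
  have h0 : ∀ᶠ x in nhds 0, u x = 0 := by
    filter_upwards [isClosed_closure.isOpen_compl.mem_nhds h0Ω] with x hx
    exact huΩ x fun h => hx (subset_closure h)
  set G := ∫ x, ‖fderiv ℝ u x‖ ^ 2 with hG
  have hG0 : 0 ≤ G := integral_nonneg fun x => by positivity
  have hGΩ : ∫ x in Ω, ‖fderiv ℝ u x‖ ^ 2 = G := by
    have hae := (ae_restrict_iff' hΩ.measurableSet.compl).1
      (ae_restrict_fderiv_eq_zero_of_forall_eq_zero (by omega)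
        (hu1.differentiable one_ne_zero) hΩ.measurableSet.compl huΩ)
    refine setIntegral_eq_integral_of_ae_compl_eq_zero ?_
    filter_upwards [hae] with x hx hxΩ
    simp [hx hxΩ]
  have hf : Integrable (fun x => |u x| ^ 2 / ‖x‖ ^ 2) := by
    simp only [sq_abs]
    refine (contDiff_sq_div_norm_sq hu1 h0).continuous.integrable_of_hasCompactSupport ?_
    refine hc.mono fun x hx => ?_
    contrapose! hx
    simp_all
  have hg : Integrable (fun x => |u x| ^ p) :=
    (hu1.continuous.abs.rpow_const fun _ => Or.inr hp0.le).integrable_of_hasCompactSupport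
      (hc.comp_left (g := fun t => |t| ^ p) (by simp [hp0.ne']))
  obtain ⟨hint, hhol⟩ := integral_rpow_mul_rpow_le hf hg (fun x => by positivity)
    (fun x => by positivity) (s := α / 2) (t := 1 - α / 2) (by linarith) (by linarith) (by ring)
  simp_rw [← rpow_mul_rpow_neg_eq (abs_nonneg _) (norm_nonneg _) hα0 hαq hpq] at hint hhol
  have hbound : ∫ x in Ω, |u x| ^ q * a x ≤ K * G ^ (q / 2) := by
    calc ∫ x in Ω, |u x| ^ q * a x
        ≤ ∫ x in Ω, c₀⁻¹ * (|u x| ^ q * ‖x‖ ^ (-α)) := by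
          refine integral_mono_of_nonneg ?_ (hint.const_mul _).integrableOn ?_
          · refine (ae_restrict_iff' hΩ.measurableSet).2 (.of_forall fun x hx => ?_)
            have : 0 ≤ a x := le_trans (by positivity) (ha x (subset_closure hx)).1
            simp only [Pi.zero_apply]
            positivity
          · refine (ae_restrict_iff' hΩ.measurableSet).2 (.of_forall fun x hx => ?_)
            calc |u x| ^ q * a x ≤ |u x| ^ q * (c₀⁻¹ * ‖x‖ ^ (-α)) := by
                  gcongr
                  exact (ha x (subset_closure hx)).2
              _ = _ := by ring
      _ ≤ ∫ x, c₀⁻¹ * (|u x| ^ q * ‖x‖ ^ (-α)) :=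
          setIntegral_le_integral (hint.const_mul _) (.of_forall fun x => by positivity)
      _ = c₀⁻¹ * ∫ x, |u x| ^ q * ‖x‖ ^ (-α) := integral_const_mul _ _
      _ ≤ c₀⁻¹ * ((4 * G) ^ (α / 2) * (S * G ^ (p / 2)) ^ (1 - α / 2)) := by
          refine mul_le_mul_of_nonneg_left (hhol.trans ?_) (by positivity)
          have hH := integral_sq_div_norm_sq_le hN hu1 hc h0
          have hS' := hSob u hu1 hc
          have hA : 0 ≤ ∫ x, |u x| ^ 2 / ‖x‖ ^ 2 := integral_nonneg fun x => by positivity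
          have hB : 0 ≤ ∫ x, |u x| ^ p := integral_nonneg fun x => by positivity
          simp only [sq_abs] at hA ⊢
          have : 0 ≤ 1 - α / 2 := by linarith
          gcongr
      _ = K * G ^ (q / 2) := by
          rw [hK, Real.mul_rpow (by norm_num) hG0, Real.mul_rpow hS.le (by positivity),
            ← Real.rpow_mul hG0, ← hexp,
            Real.rpow_add_of_nonneg hG0 (by positivity)
              (mul_nonneg (by positivity) (by linarith))]
          ring
  have hnn : 0 ≤ ∫ x in Ω, |u x| ^ q * a x :=
    setIntegral_nonneg hΩ.measurableSet fun x hx => by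
      have : 0 ≤ a x := le_trans (by positivity) (ha x (subset_closure hx)).1
      positivity
  rw [hGΩ]
  calc (∫ x in Ω, |u x| ^ q * a x) ^ q⁻¹ ≤ (K * G ^ (q / 2)) ^ q⁻¹ := by gcongr
    _ = K ^ q⁻¹ * G ^ ((1 : ℝ) / 2) := by
        rw [Real.mul_rpow hK0.le (by positivity), ← Real.rpow_mul hG0]
        congr 2
        field_simp
end

section
/- Let N = 2. For every q with 2 < q < ∞ there exists a constant C > 0, depending only on α, c₀ and q, such that for every smooth compactly supported function u : ℝ² → ℝ vanishing on ℝ² ∖ Ω one has (∫_Ω |u(x)|^{q} a(x) dx)^{1/q} ≤ C (∫_Ω |∇u(x)|² dx)^{(1/2)−(1/q)} (∫_Ω a(x)|u(x)|² dx)^{1/q}. -/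
open MeasureTheory Real
open scoped Topology

lemma Continuous.mul_norm_rpow_of_eventuallyEq_zero {E : Type*} [NormedAddCommGroup E]
    {f : E → ℝ} (hf : Continuous f) (h0 : f =ᶠ[𝓝 0] 0) (s : ℝ) :
    Continuous fun x => f x * ‖x‖ ^ s := by
  rw [continuous_iff_continuousAt]
  intro x
  rcases eq_or_ne x 0 with rfl | hx
  · refine (continuousAt_const (y := (0 : ℝ))).congr ?_
    filter_upwards [h0] with y hy
    simp [hy]
  · exact hf.continuousAt.mul
      (continuous_norm.continuousAt.rpow_const (Or.inl (norm_ne_zero_iff.2 hx)))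

section NormPower

variable {E : Type*} [NormedAddCommGroup E] [InnerProductSpace ℝ E] {f : E → ℝ}

lemma ContDiff.mul_norm_rpow_of_eventuallyEq_zero (hf : ContDiff ℝ 1 f) (h0 : f =ᶠ[𝓝 0] 0)
    (s : ℝ) : ContDiff ℝ 1 fun x => f x * ‖x‖ ^ s := by
  rw [contDiff_iff_contDiffAt]
  intro x
  rcases eq_or_ne x 0 with rfl | hx
  · refine (contDiffAt_const (c := (0 : ℝ))).congr_of_eventuallyEq ?_
    filter_upwards [h0] with y hy
    simp [hy]
  · exact hf.contDiffAt.mul ((contDiffAt_norm ℝ hx).rpow_const_of_ne (norm_ne_zero_iff.2 hx))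

lemma fderiv_mul_norm_rpow_apply (hf : Differentiable ℝ f) (h0 : f =ᶠ[𝓝 0] 0) (s : ℝ) (x v : E) :
    fderiv ℝ (fun x => f x * ‖x‖ ^ s) x v =
      fderiv ℝ f x v * ‖x‖ ^ s + s * inner ℝ x v * (f x * ‖x‖ ^ (s - 2)) := by
  rcases eq_or_ne x 0 with rfl | hx
  · have h1 : (fun x => f x * ‖x‖ ^ s) =ᶠ[𝓝 0] fun _ => 0 := by
      filter_upwards [h0] with y hy
      simp [hy]
    have h2 : fderiv ℝ f 0 = 0 := by
      rw [h0.fderiv_eq]; simp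
    rw [h1.fderiv_eq, h2]
    simp
  · have hpos : 0 < ‖x‖ := norm_pos_iff.2 hx
    have hn : HasFDerivAt (fun y : E => ‖y‖ ^ s) ((s * ‖x‖ ^ (s - 2)) • innerSL ℝ x) x := by
      have h := (hasStrictFDerivAt_norm_sq x).hasFDerivAt.rpow_const (p := s / 2)
        (Or.inl (by positivity))
      have e : (fun y : E => ‖y‖ ^ s) = fun y => (‖y‖ ^ 2) ^ (s / 2) := by
        ext y
        rw [← rpow_natCast_mul (norm_nonneg y)]
        congr 1; push_cast; ring
      rw [e]
      convert h using 1
      ext v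
      have : (‖x‖ ^ 2) ^ (s / 2 - 1) = ‖x‖ ^ (s - 2) := by
        rw [← rpow_natCast_mul (norm_nonneg x)]
        congr 1; push_cast; ring
      simp [this]
      ring
    have hm : HasFDerivAt (fun y => f y * ‖y‖ ^ s) _ x := (hf x).hasFDerivAt.mul hn
    rw [hm.fderiv]
    simp
    ring

lemma norm_fderiv_mul_norm_rpow_le (hf : Differentiable ℝ f) (h0 : f =ᶠ[𝓝 0] 0) (s : ℝ) (x : E) :
    ‖fderiv ℝ (fun x => f x * ‖x‖ ^ s) x‖ ≤
      ‖fderiv ℝ f x‖ * ‖x‖ ^ s + |s| * (|f x| * ‖x‖ ^ (s - 1)) := by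
  refine ContinuousLinearMap.opNorm_le_bound _ (by positivity) fun v => ?_
  rw [fderiv_mul_norm_rpow_apply hf h0, add_mul]
  refine (norm_add_le _ _).trans (add_le_add ?_ ?_)
  · rw [norm_mul, norm_of_nonneg (by positivity : 0 ≤ ‖x‖ ^ s), mul_right_comm]
    gcongr
    exact ContinuousLinearMap.le_opNorm _ _
  · rcases eq_or_ne x 0 with rfl | hx
    · simp [h0.eq_of_nhds]
    · have hpos : 0 < ‖x‖ := norm_pos_iff.2 hx
      rw [norm_mul, norm_mul, norm_mul, norm_of_nonneg (by positivity : 0 ≤ ‖x‖ ^ (s - 2)),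
        show s - 1 = s - 2 + 1 by ring, rpow_add_one hpos.ne', norm_eq_abs s, norm_eq_abs (f x)]
      calc |s| * ‖inner ℝ x v‖ * (|f x| * ‖x‖ ^ (s - 2))
          ≤ |s| * (‖x‖ * ‖v‖) * (|f x| * ‖x‖ ^ (s - 2)) := by
            gcongr
            exact norm_inner_le_norm x v
        _ = _ := by ring

end NormPower

/-- Integration by parts against the radial vector field `x`, whose divergence is the dimension. -/
lemma integral_fderiv_apply_self_s1 {ι : Type*} [Fintype ι] {h : EuclideanSpace ℝ ι → ℝ}
    (hh : ContDiff ℝ 1 h) (hc : HasCompactSupport h) :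
    ∫ x, fderiv ℝ h x x = -(Fintype.card ι * ∫ x, h x) := by
  classical
  have hd : Continuous (fderiv ℝ h) := hh.continuous_fderiv one_ne_zero
  set L : ι → EuclideanSpace ℝ ι →L[ℝ] ℝ := fun i => EuclideanSpace.proj i with hL
  set b : ι → EuclideanSpace ℝ ι := fun i => EuclideanSpace.single i 1 with hb
  have hi : ∀ i, Integrable fun x => L i x * fderiv ℝ h x (b i) := by
    intro i
    refine Continuous.integrable_of_hasCompactSupport (by fun_prop) ?_
    refine (hc.fderiv ℝ).mono fun x hx => ?_
    contrapose! hx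
    simp_all
  have key : ∀ i, ∫ x, L i x * fderiv ℝ h x (b i) = - ∫ x, h x := by
    intro i
    have hf : ∀ x, fderiv ℝ (L i) x (b i) = 1 := by
      intro x
      rw [ContinuousLinearMap.fderiv]
      simp [hL, hb]
    rw [integral_mul_fderiv_eq_neg_fderiv_mul_of_integrable ?_ (hi i) ?_
      (fun x _ => (L i).differentiableAt) (fun x _ => hh.differentiable one_ne_zero x)]
    · simp only [hf, one_mul]
    · simpa only [hf, one_mul] using hh.continuous.integrable_of_hasCompactSupport hc
    · exact ((L i).continuous.mul hh.continuous).integrable_of_hasCompactSupport hc.mul_left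
  have e : ∀ x, fderiv ℝ h x x = ∑ i, L i x * fderiv ℝ h x (b i) := by
    intro x
    have hx : x = ∑ i, L i x • b i := by
      simpa [hL, hb] using ((EuclideanSpace.basisFun ι ℝ).sum_repr x).symm
    calc fderiv ℝ h x x = fderiv ℝ h x (∑ i, L i x • b i) := congrArg _ hx
      _ = _ := by simp only [map_sum, map_smul, smul_eq_mul]
  simp_rw [e]
  rw [integral_finsetSum _ fun i _ => hi i]
  simp [key]

/-- The **Gagliardo-Nirenberg-Sobolev inequality** in the plane, with real-valued integrals. -/
lemma exists_integral_sq_le_sq_integral_fderiv :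
    ∃ K : ℝ, 0 ≤ K ∧ ∀ v : EuclideanSpace ℝ (Fin 2) → ℝ, ContDiff ℝ 1 v → HasCompactSupport v →
      ∫ x, v x ^ 2 ≤ K * (∫ x, ‖fderiv ℝ v x‖) ^ 2 := by
  refine ⟨lintegralPowLePowLIntegralFDerivConst (volume : Measure (EuclideanSpace ℝ (Fin 2))) 2,
    NNReal.coe_nonneg _, fun v hv hc => ?_⟩
  have hp : Real.HolderConjugate (Module.finrank ℝ (EuclideanSpace ℝ (Fin 2))) 2 := by
    rw [finrank_euclideanSpace_fin, Nat.cast_ofNat]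
    exact Real.HolderConjugate.two_two
  have h := lintegral_pow_le_pow_lintegral_fderiv volume hv hc hp
  have hi : Integrable (fderiv ℝ v) :=
    (hv.continuous_fderiv one_ne_zero).integrable_of_hasCompactSupport (hc.fderiv ℝ)
  have hvc : HasCompactSupport fun x => v x ^ 2 := hc.mono fun x hx => by
    contrapose! hx
    simp_all
  have hvi : Integrable fun x => v x ^ 2 :=
    Continuous.integrable_of_hasCompactSupport (hv.continuous.pow 2) hvc
  have e : ∫⁻ x, ‖v x‖ₑ ^ (2 : ℝ) = ENNReal.ofReal (∫ x, v x ^ 2) := by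
    rw [ofReal_integral_eq_lintegral_ofReal hvi (.of_forall fun x => sq_nonneg _)]
    refine lintegral_congr fun x => ?_
    rw [← ofReal_norm, ENNReal.ofReal_rpow_of_nonneg (norm_nonneg _) (by norm_num)]
    simp
  have hn : 0 ≤ ∫ x, ‖fderiv ℝ v x‖ := integral_nonneg fun x => norm_nonneg _
  rw [e, ← ofReal_integral_norm_eq_lintegral_enorm hi,
    ENNReal.ofReal_rpow_of_nonneg hn (by norm_num), ← ENNReal.ofReal_coe_nnreal,
    ← ENNReal.ofReal_mul (NNReal.coe_nonneg _), ENNReal.ofReal_le_ofReal_iff (by positivity)] at h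
  simpa using h

lemma integrable_norm_fderiv_mul_norm_rpow {f : EuclideanSpace ℝ (Fin 2) → ℝ}
    (hf : ContDiff ℝ 1 f) (hc : HasCompactSupport f) (h0 : f =ᶠ[𝓝 0] 0) (s : ℝ) :
    Integrable fun x => ‖fderiv ℝ f x‖ * ‖x‖ ^ s := by
  have h0' : (fun x => ‖fderiv ℝ f x‖) =ᶠ[𝓝 0] 0 := by
    filter_upwards [h0.fderiv (𝕜 := ℝ)] with x hx
    simp [hx]
  exact Continuous.integrable_of_hasCompactSupport
    ((hf.continuous_fderiv one_ne_zero).norm.mul_norm_rpow_of_eventuallyEq_zero h0' s)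
    (hc.fderiv ℝ).norm.mul_right

/-- A **Hardy inequality** in the plane, with power weights. -/
lemma integral_mul_norm_rpow_le {f : EuclideanSpace ℝ (Fin 2) → ℝ} (hf : ContDiff ℝ 1 f)
    (hc : HasCompactSupport f) (h0 : f =ᶠ[𝓝 0] 0) (s : ℝ) :
    (s + 1) * ∫ x, f x * ‖x‖ ^ (s - 1) ≤ ∫ x, ‖fderiv ℝ f x‖ * ‖x‖ ^ s := by
  have hh := hf.mul_norm_rpow_of_eventuallyEq_zero h0 (s - 1)
  have hhc : HasCompactSupport fun x => f x * ‖x‖ ^ (s - 1) := hc.mul_right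
  have hi := hh.continuous.integrable_of_hasCompactSupport (μ := volume) hhc
  have key := integral_fderiv_apply_self_s1 hh hhc
  have hd : ∀ x, -(‖fderiv ℝ f x‖ * ‖x‖ ^ s) + (s - 1) * (f x * ‖x‖ ^ (s - 1)) ≤
      fderiv ℝ (fun x => f x * ‖x‖ ^ (s - 1)) x x := by
    intro x
    rw [fderiv_mul_norm_rpow_apply (hf.differentiable one_ne_zero) h0]
    rcases eq_or_ne x 0 with rfl | hx
    · have h2 : fderiv ℝ f 0 = 0 := by
        rw [h0.fderiv_eq]; simp
      simp [h0.eq_of_nhds, h2]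
    · have hpos : 0 < ‖x‖ := norm_pos_iff.2 hx
      have e1 : ‖x‖ ^ s = ‖x‖ * ‖x‖ ^ (s - 1) := by
        rw [mul_comm, ← rpow_add_one hpos.ne']
        ring_nf
      have e2 : ‖x‖ ^ 2 * ‖x‖ ^ (s - 1 - 2) = ‖x‖ ^ (s - 1) := by
        rw [mul_comm, ← rpow_add_natCast hpos.ne']
        push_cast
        ring_nf
      have h3 := (abs_le.1 ((fderiv ℝ f x).le_opNorm x)).1
      have h4 := mul_le_mul_of_nonneg_right h3 (by positivity : 0 ≤ ‖x‖ ^ (s - 1))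
      rw [real_inner_self_eq_norm_sq, e1, show (s - 1) * ‖x‖ ^ 2 * (f x * ‖x‖ ^ (s - 1 - 2)) =
        (s - 1) * (f x * (‖x‖ ^ 2 * ‖x‖ ^ (s - 1 - 2))) by ring, e2]
      linarith
  have hI := integral_mono (((integrable_norm_fderiv_mul_norm_rpow hf hc h0 s).neg).add
    (hi.const_mul (s - 1))) ?_ hd
  · simp only [Pi.add_apply, Pi.neg_apply] at hI
    rw [integral_add ?_ ?_, integral_neg, integral_const_mul, key] at hI
    · norm_num at hI
      linarith
    · exact (integrable_norm_fderiv_mul_norm_rpow hf hc h0 s).neg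
    · exact hi.const_mul (s - 1)
  · refine Continuous.integrable_of_hasCompactSupport
      ((hh.continuous_fderiv one_ne_zero).clm_apply continuous_id) ?_
    refine (hhc.fderiv ℝ).mono fun x hx => ?_
    contrapose! hx
    simp_all

/-- A power-weighted version of the planar Gagliardo-Nirenberg-Sobolev inequality. -/
lemma exists_integral_sq_mul_norm_rpow_le {s : ℝ} (hs : -1 < s) :
    ∃ K : ℝ, 0 ≤ K ∧ ∀ f : EuclideanSpace ℝ (Fin 2) → ℝ, ContDiff ℝ 1 f → HasCompactSupport f →
      f =ᶠ[𝓝 0] 0 → (∀ x, 0 ≤ f x) →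
      ∫ x, f x ^ 2 * ‖x‖ ^ (2 * s) ≤ K * (∫ x, ‖fderiv ℝ f x‖ * ‖x‖ ^ s) ^ 2 := by
  obtain ⟨K, hK0, hK⟩ := exists_integral_sq_le_sq_integral_fderiv
  refine ⟨K * (1 + |s| / (s + 1)) ^ 2, by positivity, fun f hf hc h0 hpos => ?_⟩
  have hv := hf.mul_norm_rpow_of_eventuallyEq_zero h0 s
  have hvc : HasCompactSupport fun x => f x * ‖x‖ ^ s := hc.mul_right
  have hw : Integrable (fun x => |f x| * ‖x‖ ^ (s - 1)) volume := by
    simp_rw [abs_of_nonneg (hpos _)]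
    exact Continuous.integrable_of_hasCompactSupport
      (hf.continuous.mul_norm_rpow_of_eventuallyEq_zero h0 (s - 1)) hc.mul_right
  have hdi := integrable_norm_fderiv_mul_norm_rpow hf hc h0 s
  have hvi : Integrable (fderiv ℝ fun x => f x * ‖x‖ ^ s) volume :=
    (hv.continuous_fderiv one_ne_zero).integrable_of_hasCompactSupport (hvc.fderiv ℝ)
  have hardy := integral_mul_norm_rpow_le hf hc h0 s
  set A := ∫ x, ‖fderiv ℝ f x‖ * ‖x‖ ^ s
  have hs1 : 0 < s + 1 := by linarith
  have hle : ∫ x, ‖fderiv ℝ (fun x => f x * ‖x‖ ^ s) x‖ ≤ (1 + |s| / (s + 1)) * A := by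
    calc ∫ x, ‖fderiv ℝ (fun x => f x * ‖x‖ ^ s) x‖
        ≤ ∫ x, (‖fderiv ℝ f x‖ * ‖x‖ ^ s + |s| * (|f x| * ‖x‖ ^ (s - 1))) :=
          integral_mono hvi.norm (hdi.add (hw.const_mul _))
            fun x => norm_fderiv_mul_norm_rpow_le (hf.differentiable one_ne_zero) h0 s x
      _ = A + |s| * ∫ x, f x * ‖x‖ ^ (s - 1) := by
          rw [integral_add hdi (hw.const_mul _), integral_const_mul]
          simp_rw [abs_of_nonneg (hpos _)]
          rfl
      _ ≤ A + |s| * (A / (s + 1)) := by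
          gcongr
          rw [le_div_iff₀ hs1, mul_comm]
          exact hardy
      _ = _ := by ring
  calc ∫ x, f x ^ 2 * ‖x‖ ^ (2 * s) = ∫ x, (f x * ‖x‖ ^ s) ^ 2 := by
        congr 1 with x
        rw [mul_pow, ← rpow_mul_natCast (norm_nonneg x)]
        push_cast
        ring_nf
    _ ≤ K * (∫ x, ‖fderiv ℝ (fun x => f x * ‖x‖ ^ s) x‖) ^ 2 := hK _ hv hvc
    _ ≤ K * ((1 + |s| / (s + 1)) * A) ^ 2 := by
        gcongr
    _ = _ := by ring

lemma integrable_abs_rpow_mul_norm_rpow {u : EuclideanSpace ℝ (Fin 2) → ℝ} (hu : Continuous u)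
    (hc : HasCompactSupport u) (h0 : u =ᶠ[𝓝 0] 0) {p : ℝ} (hp : 0 < p) (s : ℝ) :
    Integrable fun x => |u x| ^ p * ‖x‖ ^ s := by
  refine Continuous.integrable_of_hasCompactSupport (Continuous.mul_norm_rpow_of_eventuallyEq_zero
    (hu.abs.rpow_const fun _ => Or.inr hp.le) ?_ s) (hc.mono fun x hx => ?_)
  · filter_upwards [h0] with x hx
    simp [hx, hp.ne']
  · contrapose! hx
    simp_all [hp.ne']

lemma exists_integral_abs_rpow_mul_norm_rpow_le {s : ℝ} (hs : -1 < s) {p : ℝ} (hp : 1 < p) :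
    ∃ K : ℝ, 0 ≤ K ∧ ∀ Ω : Set (EuclideanSpace ℝ (Fin 2)), MeasurableSet Ω →
      ∀ u : EuclideanSpace ℝ (Fin 2) → ℝ, ContDiff ℝ 1 u → HasCompactSupport u →
      u =ᶠ[𝓝 0] 0 → (∀ x ∉ Ω, u x = 0) →
      ∫ x, |u x| ^ (2 * p) * ‖x‖ ^ (2 * s) ≤
        K * (∫ x in Ω, ‖fderiv ℝ u x‖ ^ 2) * ∫ x, |u x| ^ (2 * (p - 1)) * ‖x‖ ^ (2 * s) := by
  obtain ⟨K, hK0, hK⟩ := exists_integral_sq_mul_norm_rpow_le hs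
  refine ⟨K * p ^ 2, by positivity, fun Ω hΩ u hu hc h0 hz => ?_⟩
  have hp1 : 0 < p - 1 := by linarith
  have hfc : HasCompactSupport fun x => ‖u x‖ ^ p := hc.mono fun x hx => by
    contrapose! hx
    simp_all [(by linarith : p ≠ 0)]
  have hf0 : (fun x => ‖u x‖ ^ p) =ᶠ[𝓝 0] 0 := by
    filter_upwards [h0] with x hx
    simp [hx, (by linarith : p ≠ 0)]
  have hf := hu.norm_rpow hp
  have h1 := hK _ hf hfc hf0 fun x => by positivity
  have hgc : Continuous fun x => |u x| ^ (p - 1) * ‖x‖ ^ s := by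
    refine Continuous.mul_norm_rpow_of_eventuallyEq_zero
      (hu.continuous.abs.rpow_const fun _ => Or.inr hp1.le) ?_ s
    filter_upwards [h0] with x hx
    simp [hx, hp1.ne']
  have hgs : HasCompactSupport fun x => |u x| ^ (p - 1) * ‖x‖ ^ s := hc.mono fun x hx => by
    contrapose! hx
    simp_all [hp1.ne']
  have hdc := (hu.continuous_fderiv one_ne_zero).norm
  have hds := (hc.fderiv ℝ).norm
  have hcs : ∫ x, ‖fderiv ℝ (fun x => ‖u x‖ ^ p) x‖ * ‖x‖ ^ s ≤
      p * ((∫ x, |u x| ^ (2 * (p - 1)) * ‖x‖ ^ (2 * s)) ^ (1 / 2 : ℝ) *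
        (∫ x in Ω, ‖fderiv ℝ u x‖ ^ 2) ^ (1 / 2 : ℝ)) := by
    have hsq : ∀ x, (|u x| ^ (p - 1) * ‖x‖ ^ s) ^ (2 : ℝ) =
        |u x| ^ (2 * (p - 1)) * ‖x‖ ^ (2 * s) := by
      intro x
      rw [mul_rpow (by positivity) (by positivity), ← rpow_mul (abs_nonneg _),
        ← rpow_mul (norm_nonneg _), mul_comm 2, mul_comm 2]
    calc ∫ x, ‖fderiv ℝ (fun x => ‖u x‖ ^ p) x‖ * ‖x‖ ^ s
        ≤ ∫ x, p * (|u x| ^ (p - 1) * ‖x‖ ^ s * ‖fderiv ℝ u x‖) := by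
          refine integral_mono (integrable_norm_fderiv_mul_norm_rpow hf hfc hf0 s) ?_ fun x => ?_
          · exact (Continuous.integrable_of_hasCompactSupport (hgc.mul hdc)
              hgs.mul_right).const_mul p
          · have := mul_le_mul_of_nonneg_right
              (norm_fderiv_norm_rpow_le (hu.differentiable one_ne_zero) (x := x) hp)
              (by positivity : 0 ≤ ‖x‖ ^ s)
            refine this.trans_eq ?_
            rw [norm_eq_abs]
            ring
      _ = p * ∫ x in Ω, |u x| ^ (p - 1) * ‖x‖ ^ s * ‖fderiv ℝ u x‖ := by
          rw [integral_const_mul, setIntegral_eq_integral_of_forall_compl_eq_zero]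
          intro x hx
          simp [hz x hx, hp1.ne']
      _ ≤ p * ((∫ x in Ω, (|u x| ^ (p - 1) * ‖x‖ ^ s) ^ (2 : ℝ)) ^ (1 / 2 : ℝ) *
            (∫ x in Ω, ‖fderiv ℝ u x‖ ^ (2 : ℝ)) ^ (1 / 2 : ℝ)) := by
          gcongr
          refine integral_mul_le_Lp_mul_Lq_of_nonneg Real.HolderConjugate.two_two
            (.of_forall fun x => by positivity) (.of_forall fun x => by positivity) ?_ ?_
          · exact (hgc.memLp_of_hasCompactSupport hgs).restrict Ω
          · exact (hdc.memLp_of_hasCompactSupport hds).restrict Ω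
      _ = _ := by
          simp_rw [hsq, rpow_two]
          rw [setIntegral_eq_integral_of_forall_compl_eq_zero]
          intro x hx
          simp [hz x hx, hp1.ne']
  have hI : 0 ≤ ∫ x, |u x| ^ (2 * (p - 1)) * ‖x‖ ^ (2 * s) :=
    integral_nonneg fun x => by positivity
  have hD : 0 ≤ ∫ x in Ω, ‖fderiv ℝ u x‖ ^ 2 := integral_nonneg fun x => by positivity
  have hA : 0 ≤ ∫ x, ‖fderiv ℝ (fun x => ‖u x‖ ^ p) x‖ * ‖x‖ ^ s :=
    integral_nonneg fun x => by positivity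
  calc ∫ x, |u x| ^ (2 * p) * ‖x‖ ^ (2 * s)
      = ∫ x, (‖u x‖ ^ p) ^ 2 * ‖x‖ ^ (2 * s) := by
        congr 1 with x
        rw [norm_eq_abs, ← rpow_mul_natCast (abs_nonneg _), mul_comm 2 p]
        norm_num
    _ ≤ _ := h1
    _ ≤ K * (p * ((∫ x, |u x| ^ (2 * (p - 1)) * ‖x‖ ^ (2 * s)) ^ (1 / 2 : ℝ) *
        (∫ x in Ω, ‖fderiv ℝ u x‖ ^ 2) ^ (1 / 2 : ℝ))) ^ 2 := by gcongr
    _ = _ := by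
        rw [mul_pow, mul_pow, ← sqrt_eq_rpow, ← sqrt_eq_rpow, sq_sqrt hI, sq_sqrt hD]
        ring

lemma exists_integral_abs_rpow_mul_norm_rpow_le_pow {s : ℝ} (hs : -1 < s) (k : ℕ) :
    ∃ K : ℝ, 0 ≤ K ∧ ∀ Ω : Set (EuclideanSpace ℝ (Fin 2)), MeasurableSet Ω →
      ∀ u : EuclideanSpace ℝ (Fin 2) → ℝ, ContDiff ℝ 1 u → HasCompactSupport u →
      u =ᶠ[𝓝 0] 0 → (∀ x ∉ Ω, u x = 0) →
      ∫ x, |u x| ^ (2 * (k + 1 : ℝ)) * ‖x‖ ^ (2 * s) ≤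
        K * (∫ x in Ω, ‖fderiv ℝ u x‖ ^ 2) ^ k * ∫ x, |u x| ^ (2 : ℝ) * ‖x‖ ^ (2 * s) := by
  induction k with
  | zero => exact ⟨1, zero_le_one, fun Ω _ u _ _ _ _ => by simp⟩
  | succ k ih =>
    obtain ⟨K, hK0, hK⟩ := ih
    obtain ⟨L, hL0, hL⟩ := exists_integral_abs_rpow_mul_norm_rpow_le hs (p := k + 2)
      (by linarith [k.cast_nonneg (α := ℝ)])
    refine ⟨L * K, by positivity, fun Ω hΩ u hu hc h0 hz => ?_⟩
    have h1 := hL Ω hΩ u hu hc h0 hz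
    have h2 := hK Ω hΩ u hu hc h0 hz
    have hD : 0 ≤ ∫ x in Ω, ‖fderiv ℝ u x‖ ^ 2 := integral_nonneg fun x => by positivity
    rw [show (k : ℝ) + 2 - 1 = k + 1 by ring] at h1
    rw [show ((k + 1 : ℕ) : ℝ) + 1 = k + 2 by push_cast; ring]
    refine (h1.trans (mul_le_mul_of_nonneg_left h2 (by positivity))).trans_eq ?_
    ring

lemma rpow_le_add_rpow_of_le {y t q r : ℝ} (hy : 0 ≤ y) (ht : 0 < t) (hq : 2 ≤ q) (hqr : q ≤ r) :
    y ^ q ≤ t ^ (q - 2) * y ^ (2 : ℝ) + t ^ (q - r) * y ^ r := by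
  rcases le_total y t with h | h
  · have h1 : y ^ (q - 2) * y ^ (2 : ℝ) = y ^ q := by
      rw [← rpow_add' hy (by linarith)]
      ring_nf
    have h2 : y ^ (q - 2) ≤ t ^ (q - 2) := rpow_le_rpow hy h (by linarith)
    have h3 := mul_le_mul_of_nonneg_right h2 (by positivity : 0 ≤ y ^ (2 : ℝ))
    have h4 : 0 ≤ t ^ (q - r) * y ^ r := by positivity
    linarith
  · have h1 : y ^ (q - r) * y ^ r = y ^ q := by
      rw [← rpow_add (ht.trans_le h)]
      ring_nf
    have h2 : y ^ (q - r) ≤ t ^ (q - r) := rpow_le_rpow_of_nonpos ht h (by linarith)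
    have h3 := mul_le_mul_of_nonneg_right h2 (by positivity : 0 ≤ y ^ r)
    have h4 : 0 ≤ t ^ (q - 2) * y ^ (2 : ℝ) := by positivity
    linarith

/-- The planar **Gagliardo-Nirenberg inequality** with weight `‖x‖ ^ (2 * s)`, for functions
vanishing near the origin. -/
theorem exists_integral_abs_rpow_mul_norm_rpow_le_rpow {s q : ℝ} (hs : -1 < s) (hq : 2 < q) :
    ∃ K : ℝ, 0 < K ∧ ∀ Ω : Set (EuclideanSpace ℝ (Fin 2)), MeasurableSet Ω →
      ∀ u : EuclideanSpace ℝ (Fin 2) → ℝ, ContDiff ℝ 1 u → HasCompactSupport u →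
      u =ᶠ[𝓝 0] 0 → (∀ x ∉ Ω, u x = 0) →
      ∫ x, |u x| ^ q * ‖x‖ ^ (2 * s) ≤
        K * (∫ x in Ω, ‖fderiv ℝ u x‖ ^ 2) ^ (q / 2 - 1) *
          ∫ x, |u x| ^ (2 : ℝ) * ‖x‖ ^ (2 * s) := by
  set k := ⌈q⌉₊
  have hk : q ≤ k := Nat.le_ceil q
  obtain ⟨K, hK0, hK⟩ := exists_integral_abs_rpow_mul_norm_rpow_le_pow hs k
  refine ⟨1 + K, by positivity, fun Ω hΩ u hu hc h0 hz => ?_⟩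
  have h1 := hK Ω hΩ u hu hc h0 hz
  have hi := fun {p : ℝ} (hp : 0 < p) =>
    integrable_abs_rpow_mul_norm_rpow hu.continuous hc h0 hp (2 * s)
  have hD : 0 ≤ ∫ x in Ω, ‖fderiv ℝ u x‖ ^ 2 := integral_nonneg fun x => by positivity
  have hI : 0 ≤ ∫ x, |u x| ^ (2 : ℝ) * ‖x‖ ^ (2 * s) := integral_nonneg fun x => by positivity
  set D := ∫ x in Ω, ‖fderiv ℝ u x‖ ^ 2
  set I := ∫ x, |u x| ^ (2 : ℝ) * ‖x‖ ^ (2 * s)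
  have key : ∀ t, √D < t → ∫ x, |u x| ^ q * ‖x‖ ^ (2 * s) ≤ (1 + K) * t ^ (q - 2) * I := by
    intro t hDt
    have ht : 0 < t := (sqrt_nonneg D).trans_lt hDt
    have hDt2 : D ≤ t ^ 2 := (sqrt_le_left ht.le).1 hDt.le
    calc ∫ x, |u x| ^ q * ‖x‖ ^ (2 * s)
        ≤ ∫ x, (t ^ (q - 2) * (|u x| ^ (2 : ℝ) * ‖x‖ ^ (2 * s)) +
            t ^ (q - 2 * (k + 1)) * (|u x| ^ (2 * (k + 1 : ℝ)) * ‖x‖ ^ (2 * s))) := by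
          refine integral_mono (hi (by linarith)) (((hi two_pos).const_mul _).add
            ((hi (by positivity)).const_mul _)) fun x => ?_
          have h := mul_le_mul_of_nonneg_right (rpow_le_add_rpow_of_le (abs_nonneg (u x)) ht hq.le
            (by linarith : q ≤ 2 * (k + 1))) (by positivity : 0 ≤ ‖x‖ ^ (2 * s))
          refine h.trans_eq ?_
          ring
      _ = t ^ (q - 2) * I +
            t ^ (q - 2 * (k + 1)) * ∫ x, |u x| ^ (2 * (k + 1 : ℝ)) * ‖x‖ ^ (2 * s) := by
          rw [integral_add ((hi two_pos).const_mul _) ((hi (by positivity)).const_mul _),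
            integral_const_mul, integral_const_mul]
      _ ≤ t ^ (q - 2) * I + t ^ (q - 2 * (k + 1)) * (K * (t ^ 2) ^ k * I) := by
          gcongr
          exact h1.trans (by gcongr)
      _ = t ^ (q - 2) * I + K * (t ^ (q - 2 * (k + 1)) * (t ^ 2) ^ k) * I := by ring
      _ = _ := by
          rw [← pow_mul, ← rpow_add_natCast ht.ne']
          push_cast
          ring_nf
  have hlim : Filter.Tendsto (fun t => (1 + K) * t ^ (q - 2) * I) (𝓝[>] √D)
      (𝓝 ((1 + K) * √D ^ (q - 2) * I)) := by
    have h : ContinuousAt (fun t : ℝ => t ^ (q - 2)) √D :=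
      continuousAt_rpow_const _ _ (Or.inr (by linarith))
    exact ((h.tendsto.mono_left nhdsWithin_le_nhds).const_mul _).mul_const _
  have h2 := ge_of_tendsto hlim (by filter_upwards [self_mem_nhdsWithin] with t ht using key t ht)
  rwa [sqrt_eq_rpow, ← rpow_mul hD, show 1 / 2 * (q - 2) = q / 2 - 1 by ring] at h2

/-- **Weighted Gagliardo–Nirenberg inequality (Lemma 2.5, case `N = 2`).**
For every `2 < q < ∞` there exists `C > 0` depending only on `α`, `c₀`, `q` such that
for every exterior domain `Ω ⊂ ℝ²` with `0 ∉ closure Ω`, every weight `a` with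
`c₀ |x|^(-α) ≤ a x ≤ c₀⁻¹ |x|^(-α)` on `closure Ω`, and every smooth compactly
supported `u` vanishing outside `Ω`, one has
`‖u‖_{L^q(a dx)} ≤ C ‖∇u‖_{L²}^{1/2 - 1/q} ‖u‖_{L²(a dx)}^{1/q}`. -/
theorem stmt1 (α c₀ : ℝ) (hα : 0 ≤ α ∧ α < 1) (hc₀ : 0 < c₀ ∧ c₀ < 1)
    (q : ℝ) (hq : 2 < q) :
    ∃ C : ℝ, 0 < C ∧
      ∀ (Ω : Set (EuclideanSpace ℝ (Fin 2))), IsOpen Ω →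
        (0 : EuclideanSpace ℝ (Fin 2)) ∉ closure Ω →
      ∀ a : EuclideanSpace ℝ (Fin 2) → ℝ,
        (∀ x ∈ closure Ω, c₀ * ‖x‖ ^ (-α) ≤ a x ∧ a x ≤ c₀⁻¹ * ‖x‖ ^ (-α)) →
      ∀ u : EuclideanSpace ℝ (Fin 2) → ℝ, ContDiff ℝ (⊤ : ℕ∞) u → HasCompactSupport u →
        (∀ x ∉ Ω, u x = 0) →
        (∫ x in Ω, |u x| ^ q * a x) ^ q⁻¹
          ≤ C * (∫ x in Ω, ‖fderiv ℝ u x‖ ^ 2) ^ ((1 : ℝ) / 2 - 1 / q)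
              * (∫ x in Ω, a x * (u x) ^ 2) ^ q⁻¹ := by
  obtain ⟨K, hK0, hK⟩ := exists_integral_abs_rpow_mul_norm_rpow_le_rpow
    (s := -(α / 2)) (by linarith) hq
  have hc := hc₀.1
  refine ⟨(c₀⁻¹ * K * c₀⁻¹) ^ q⁻¹, by positivity, fun Ω hΩ h0Ω a ha u hu hcu hz => ?_⟩
  have hq0 : 0 < q := by linarith
  have hD : 0 ≤ ∫ x in Ω, ‖fderiv ℝ u x‖ ^ 2 := integral_nonneg fun x => by positivity
  have ha0 : ∀ x ∈ Ω, 0 ≤ a x := fun x hx =>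
    le_trans (by positivity) (ha x (subset_closure hx)).1
  have hJ : 0 ≤ ∫ x in Ω, a x * u x ^ 2 :=
    setIntegral_nonneg hΩ.measurableSet fun x hx => mul_nonneg (ha0 x hx) (sq_nonneg _)
  by_cases hint : IntegrableOn (fun x => |u x| ^ q * a x) Ω
  swap
  · rw [integral_undef hint, zero_rpow (by positivity)]
    positivity
  have hu1 : ContDiff ℝ 1 u := hu.of_le (by exact_mod_cast le_top)
  have hu0 : u =ᶠ[𝓝 0] 0 := by
    filter_upwards [isClosed_closure.isOpen_compl.mem_nhds h0Ω] with x hx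
    exact hz x fun h => hx (subset_closure h)
  have hi := fun {p : ℝ} (hp : 0 < p) =>
    integrable_abs_rpow_mul_norm_rpow hu1.continuous hcu hu0 hp (2 * -(α / 2))
  have hmain := hK Ω hΩ.measurableSet u hu1 hcu hu0 hz
  rw [show 2 * -(α / 2) = -α by ring] at hmain hi
  have hset : ∀ {p : ℝ}, 0 < p →
      ∫ x in Ω, |u x| ^ p * ‖x‖ ^ (-α) = ∫ x, |u x| ^ p * ‖x‖ ^ (-α) := fun hp =>
    setIntegral_eq_integral_of_forall_compl_eq_zero fun x hx => by simp [hz x hx, hp.ne']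
  have hupper : ∫ x in Ω, |u x| ^ q * a x ≤ c₀⁻¹ * ∫ x, |u x| ^ q * ‖x‖ ^ (-α) := by
    rw [← hset hq0, ← integral_const_mul]
    refine setIntegral_mono_on hint ((hi hq0).integrableOn.const_mul _) hΩ.measurableSet
      fun x hx => ?_
    have h := mul_le_mul_of_nonneg_left (ha x (subset_closure hx)).2
      (by positivity : 0 ≤ |u x| ^ q)
    linarith
  have hmeas : AEStronglyMeasurable (fun x => a x * u x ^ 2) (volume.restrict Ω) := by
    have hm : AEStronglyMeasurable (fun x => |u x| ^ q * a x * |u x| ^ (2 - q))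
        (volume.restrict Ω) :=
      hint.aestronglyMeasurable.mul
        (hu1.continuous.measurable.norm.pow_const (2 - q)).aestronglyMeasurable
    refine hm.congr (.of_forall fun x => ?_)
    rcases eq_or_ne (u x) 0 with h | h
    · simp [h, hq0.ne']
    · have : |u x| ^ q * |u x| ^ (2 - q) = u x ^ 2 := by
        rw [← rpow_add (abs_pos.2 h), add_sub_cancel, rpow_two, sq_abs]
      simp only
      rw [mul_right_comm, this, mul_comm]
  have hJi : IntegrableOn (fun x => a x * u x ^ 2) Ω := by
    refine Integrable.mono' ((hi two_pos).integrableOn.const_mul c₀⁻¹) hmeas ?_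
    filter_upwards [ae_restrict_mem hΩ.measurableSet] with x hx
    rw [norm_of_nonneg (mul_nonneg (ha0 x hx) (sq_nonneg _)), rpow_two, sq_abs]
    have h := mul_le_mul_of_nonneg_right (ha x (subset_closure hx)).2 (sq_nonneg (u x))
    linarith
  have hlower : ∫ x, |u x| ^ (2 : ℝ) * ‖x‖ ^ (-α) ≤ c₀⁻¹ * ∫ x in Ω, a x * u x ^ 2 := by
    rw [← hset two_pos, ← integral_const_mul]
    refine setIntegral_mono_on (hi two_pos).integrableOn (hJi.const_mul _) hΩ.measurableSet
      fun x hx => ?_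
    rw [rpow_two, sq_abs, ← div_eq_inv_mul, le_div_iff₀ hc]
    have h := mul_le_mul_of_nonneg_right (ha x (subset_closure hx)).1 (sq_nonneg (u x))
    linarith
  have hL : 0 ≤ ∫ x in Ω, |u x| ^ q * a x :=
    setIntegral_nonneg hΩ.measurableSet fun x hx => mul_nonneg (by positivity) (ha0 x hx)
  set D := ∫ x in Ω, ‖fderiv ℝ u x‖ ^ 2
  set J := ∫ x in Ω, a x * u x ^ 2
  have hfin : ∫ x in Ω, |u x| ^ q * a x ≤ c₀⁻¹ * K * c₀⁻¹ * D ^ (q / 2 - 1) * J :=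
    calc ∫ x in Ω, |u x| ^ q * a x ≤ c₀⁻¹ * (K * D ^ (q / 2 - 1) * (c₀⁻¹ * J)) := by
          refine hupper.trans ?_
          gcongr
          refine hmain.trans ?_
          gcongr
      _ = _ := by ring
  refine (rpow_le_rpow hL hfin (by positivity)).trans_eq ?_
  rw [mul_rpow (by positivity) hJ, mul_rpow (by positivity) (by positivity), ← rpow_mul hD]
  congr 3
  field_simp
end

section
/- Suppose h ≥ 0 is such that for every δ > 0 there exists R > 0 with |∇A₀(x)|² ≤ (h + δ) a(x) A₀(x) for all x ∈ ℝ^N with |x| ≥ R. Then for every ε > 0 there exists a constant c₀ ≥ 0 such that the function A(x) := A₀(x) + c₀ satisfies |∇A(x)|² ≤ (h + ε) a(x) A(x) for ALL x ∈ Ω. -/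
open MeasureTheory Real

/-- **Lemma 3.1.** If `|∇A₀|² ≤ (h+δ) a A₀` outside a large ball for every `δ > 0`,
then for every `ε > 0` there is a constant `c₀ ≥ 0` such that `A = A₀ + c₀` satisfies
`|∇A|² ≤ (h+ε) a A` on all of the exterior domain `Ω`. -/
theorem stmt2 (N : ℕ) (hN : 2 ≤ N) (Ω : Set (EuclideanSpace ℝ (Fin N)))
    (hΩopen : IsOpen Ω) (hΩconn : IsConnected Ω) (hΩcompl : IsCompact Ωᶜ)
    (hΩ0 : (0 : EuclideanSpace ℝ (Fin N)) ∉ closure Ω)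
    (a : EuclideanSpace ℝ (Fin N) → ℝ) (ha_cont : Continuous a) (ha_pos : ∀ x, 0 < a x)
    (a₁ α : ℝ) (ha₁ : 0 < a₁) (hα : 0 ≤ α ∧ α < 1)
    (ha_lb : ∀ x : EuclideanSpace ℝ (Fin N), a₁ * (1 + ‖x‖) ^ (-α) ≤ a x)
    (A₀ : EuclideanSpace ℝ (Fin N) → ℝ) (hA₀ : ContDiff ℝ 2 A₀)
    (A₁ : ℝ) (hA₁ : 0 < A₁)
    (hA₀lb : ∀ x : EuclideanSpace ℝ (Fin N), A₁ * (1 + ‖x‖) ^ (2 - α) ≤ A₀ x)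
    (h : ℝ) (hh : 0 ≤ h)
    (hgrad : ∀ δ > (0 : ℝ), ∃ R > (0 : ℝ), ∀ x : EuclideanSpace ℝ (Fin N), R ≤ ‖x‖ →
      ‖gradient A₀ x‖ ^ 2 ≤ (h + δ) * a x * A₀ x) :
    ∀ ε > (0 : ℝ), ∃ c₀ ≥ (0 : ℝ), ∀ x ∈ Ω,
      ‖gradient A₀ x‖ ^ 2 ≤ (h + ε) * a x * (A₀ x + c₀) := by
  intro ε hε
  obtain ⟨R, -, hR⟩ := hgrad ε hε
  have hpos : ∀ x, 0 < (h + ε) * a x := fun x => mul_pos (by linarith) (ha_pos x)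
  have hA₀nonneg : ∀ x, 0 ≤ A₀ x := fun x => le_trans (by positivity) (hA₀lb x)
  have hgrad_cont : Continuous (gradient A₀) :=
    (InnerProductSpace.toDual ℝ (EuclideanSpace ℝ (Fin N))).symm.continuous.comp
      (hA₀.continuous_fderiv (by norm_num))
  have hquot_cont : Continuous fun x => ‖gradient A₀ x‖ ^ 2 / ((h + ε) * a x) :=
    (hgrad_cont.norm.pow 2).div (continuous_const.mul ha_cont) fun x => (hpos x).ne'
  obtain ⟨M, hM⟩ :=
    (isCompact_closedBall (0 : EuclideanSpace ℝ (Fin N)) R).bddAbove_image hquot_cont.continuousOn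
  refine ⟨max M 0, le_max_right _ _, fun x _ => ?_⟩
  rcases le_total R ‖x‖ with hx | hx
  · exact (hR x hx).trans (mul_le_mul_of_nonneg_left
      (le_add_of_nonneg_right (le_max_right _ _)) (hpos x).le)
  · have hxM : ‖gradient A₀ x‖ ^ 2 / ((h + ε) * a x) ≤ M :=
      hM (Set.mem_image_of_mem _ (mem_closedBall_zero_iff.mpr hx))
    rw [← div_le_iff₀' (hpos x)]
    exact hxM.trans ((le_max_left _ _).trans (le_add_of_nonneg_left (hA₀nonneg x)))
end

section
/- Let β > 0 and t ≥ 0. For every smooth compactly supported function u : ℝ^N → ℝ vanishing on ℝ^N ∖ Ω one has the Hardy-type inequality (β/(1+t)) ∫_Ω a(x) |u(x)|² Φ_{A,β}(x,t) dx ≤ ∫_Ω |∇u(x)|² Φ_{A,β}(x,t) dx. -/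
open MeasureTheory Real

/-- The Laplacian of `f : ℝ^N → ℝ`, as the sum of the second partial derivatives. -/
noncomputable def lap {N : ℕ} (f : EuclideanSpace ℝ (Fin N) → ℝ)
    (x : EuclideanSpace ℝ (Fin N)) : ℝ :=
  ∑ i : Fin N, fderiv ℝ (fun y => fderiv ℝ f y (EuclideanSpace.single i 1)) x
    (EuclideanSpace.single i 1)

/-- The squared operator norm of a linear functional is the sum of its squared coordinates. -/
lemma EuclideanSpace.norm_sq_dual_eq_sum {N : ℕ} (L : EuclideanSpace ℝ (Fin N) →L[ℝ] ℝ) :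
    ‖L‖ ^ 2 = ∑ i : Fin N, (L (EuclideanSpace.single i 1)) ^ 2 := by
  obtain ⟨v, rfl⟩ := (InnerProductSpace.toDual ℝ (EuclideanSpace ℝ (Fin N))).surjective L
  simp [EuclideanSpace.norm_sq_eq, EuclideanSpace.inner_single_right]

/-- Green's identity on `ℝ^N`, for a compactly supported test function. -/
lemma integral_mul_lap_eq {N : ℕ} {w A : EuclideanSpace ℝ (Fin N) → ℝ}
    (hw : ContDiff ℝ 1 w) (hws : HasCompactSupport w) (hA : ContDiff ℝ 2 A) :
    ∫ x, w x * lap A x = ∫ x, -∑ i : Fin N, fderiv ℝ w x (EuclideanSpace.single i 1) *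
      fderiv ℝ A x (EuclideanSpace.single i 1) := by
  have hdA (i : Fin N) :
      ContDiff ℝ 1 (fun y => fderiv ℝ A y (EuclideanSpace.single i 1)) :=
    (hA.fderiv_right (m := 1) (by norm_num)).clm_apply contDiff_const
  have hdw (i : Fin N) :
      Continuous (fun y => fderiv ℝ w y (EuclideanSpace.single i 1)) :=
    (hw.continuous_fderiv one_ne_zero).clm_apply continuous_const
  have hddA (i : Fin N) : Continuous (fun x => fderiv ℝ
      (fun y => fderiv ℝ A y (EuclideanSpace.single i 1)) x (EuclideanSpace.single i 1)) :=
    ((hdA i).continuous_fderiv one_ne_zero).clm_apply continuous_const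
  have hint₁ (i : Fin N) : Integrable (fun x => w x * fderiv ℝ
      (fun y => fderiv ℝ A y (EuclideanSpace.single i 1)) x (EuclideanSpace.single i 1)) :=
    (hw.continuous.mul (hddA i)).integrable_of_hasCompactSupport hws.mul_right
  have hint₂ (i : Fin N) : Integrable (fun x => fderiv ℝ w x (EuclideanSpace.single i 1) *
      fderiv ℝ A x (EuclideanSpace.single i 1)) :=
    ((hdw i).mul (hdA i).continuous).integrable_of_hasCompactSupport
      (hws.fderiv_apply ℝ _).mul_right
  have hint₃ (i : Fin N) : Integrable (fun x => w x *
      fderiv ℝ A x (EuclideanSpace.single i 1)) :=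
    (hw.continuous.mul (hdA i).continuous).integrable_of_hasCompactSupport hws.mul_right
  simp only [lap, Finset.mul_sum]
  rw [integral_neg, integral_finsetSum _ fun i _ => hint₁ i,
    integral_finsetSum _ fun i _ => hint₂ i, ← Finset.sum_neg_distrib]
  refine Finset.sum_congr rfl fun i _ => ?_
  exact integral_mul_fderiv_eq_neg_fderiv_mul_of_integrable (hint₂ i) (hint₁ i) (hint₃ i)
    (fun x _ => hw.differentiable one_ne_zero x)
    (fun x _ => (hdA i).differentiable one_ne_zero x)

/-- **Lemma 3.4 (Hardy-type inequality).** If `ΔA = a` and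
`Φ_{A,β}(x,t) = exp(β A(x)/(1+t))`, then for every smooth compactly supported `u`
vanishing outside `Ω`,
`(β/(1+t)) ∫_Ω a |u|² Φ dx ≤ ∫_Ω |∇u|² Φ dx`. -/
theorem stmt4 (N : ℕ) (hN : 2 ≤ N) (Ω : Set (EuclideanSpace ℝ (Fin N))) (hΩ : IsOpen Ω)
    (a A : EuclideanSpace ℝ (Fin N) → ℝ) (ha : Continuous a) (hA : ContDiff ℝ 2 A)
    (hPoisson : ∀ x, lap A x = a x)
    (β : ℝ) (hβ : 0 < β) (t : ℝ) (ht : 0 ≤ t)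
    (u : EuclideanSpace ℝ (Fin N) → ℝ) (hu : ContDiff ℝ (⊤ : ℕ∞) u)
    (hsupp : HasCompactSupport u) (hzero : ∀ x ∉ Ω, u x = 0) :
    (β / (1 + t)) * ∫ x in Ω, a x * (u x) ^ 2 * Real.exp (β * A x / (1 + t))
      ≤ ∫ x in Ω, ‖fderiv ℝ u x‖ ^ 2 * Real.exp (β * A x / (1 + t)) := by
  set κ := β / (1 + t) with hκ
  have hexp (x) : β * A x / (1 + t) = κ * A x := by rw [hκ]; ring
  simp only [hexp]
  have hu1 : ContDiff ℝ 1 u := hu.of_le (by exact_mod_cast le_top)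
  have hA1 : ContDiff ℝ 1 A := hA.of_le (by norm_num)
  set w : EuclideanSpace ℝ (Fin N) → ℝ := fun x => u x ^ 2 * exp (κ * A x) with hw_def
  have hw : ContDiff ℝ 1 w := (hu1.pow 2).mul (contDiff_const.mul hA1).exp
  have hws : HasCompactSupport w :=
    hsupp.mono fun x hx hux => hx (by simp [hw_def, hux])
  have hdw (x v) : fderiv ℝ w x v =
      (2 * u x * fderiv ℝ u x v + κ * u x ^ 2 * fderiv ℝ A x v) * exp (κ * A x) := by
    have h₁ := (hu1.differentiable one_ne_zero x).hasFDerivAt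
    have h₂ := (hA1.differentiable one_ne_zero x).hasFDerivAt
    rw [show fderiv ℝ w x = _ from ((h₁.pow 2).mul (h₂.const_mul κ).exp).fderiv]
    simp
    ring
  have hdu : Continuous (fderiv ℝ u) := hu1.continuous_fderiv one_ne_zero
  have hdA : Continuous (fderiv ℝ A) := hA1.continuous_fderiv one_ne_zero
  have hdwc : Continuous (fderiv ℝ w) := hw.continuous_fderiv one_ne_zero
  set F : EuclideanSpace ℝ (Fin N) → ℝ := fun x =>
    -∑ i : Fin N, fderiv ℝ w x (EuclideanSpace.single i 1) *
      fderiv ℝ A x (EuclideanSpace.single i 1) with hF_def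
  have hF_cont : Continuous F := by fun_prop
  have hF_supp : HasCompactSupport F := by
    refine (hws.fderiv ℝ).mono fun x hx hux => hx ?_
    simp [hF_def, hux]
  have hF_zero (x) (hx : x ∉ Ω) : F x = 0 := by
    simp [hF_def, hdw, hzero x hx]
  have hgreen : ∫ x in Ω, a x * u x ^ 2 * exp (κ * A x) = ∫ x in Ω, F x := by
    rw [setIntegral_eq_integral_of_forall_compl_eq_zero hF_zero,
      setIntegral_eq_integral_of_forall_compl_eq_zero fun x hx => by simp [hzero x hx],
      ← integral_mul_lap_eq hw hws hA]
    refine integral_congr_ae (.of_forall fun x => ?_)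
    simp only [hPoisson, hw_def]
    ring
  rw [hgreen, ← integral_const_mul]
  refine setIntegral_mono
    ((hF_cont.integrable_of_hasCompactSupport hF_supp).const_mul κ).integrableOn
    (Continuous.integrable_of_hasCompactSupport (by have := hA.continuous; fun_prop) ?_).integrableOn
    fun x => ?_
  · refine (hsupp.fderiv ℝ).mono fun x hx hux => hx ?_
    simp [hux]
  · simp only [hF_def, hdw, EuclideanSpace.norm_sq_dual_eq_sum, Finset.sum_mul, mul_neg,
      Finset.mul_sum, ← Finset.sum_neg_distrib]
    refine Finset.sum_le_sum fun i _ => ?_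
    set p := fderiv ℝ u x (EuclideanSpace.single i 1)
    set q := fderiv ℝ A x (EuclideanSpace.single i 1)
    have := mul_nonneg (sq_nonneg (p + κ * u x * q)) (exp_pos (κ * A x)).le
    linarith
end

section
/- Let Φ ∈ C²(closure(Ω) × [0,∞)) satisfy Φ > 0 and ∂_tΦ < 0 everywhere. Then for every t > 0 the function t ↦ ∫_Ω (|∇u(x,t)|² + |u_t(x,t)|²) Φ(x,t) dx is differentiable, with derivative equal to ∫_Ω (∂_tΦ)^{−1} |(∂_tΦ)∇u − u_t ∇Φ|² dx + ∫_Ω (−2a(x)Φ + ∂_tΦ − (∂_tΦ)^{−1}|∇Φ|²) |u_t|² dx, where ∇ denotes the spatial gradient. -/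
open MeasureTheory Real

open Filter Topology

section Segment

variable {E : Type*} [NormedAddCommGroup E] [NormedSpace ℝ E]

/-- A segment joining a point of an open set to a point outside meets the frontier. -/
theorem IsOpen.exists_mem_segment_frontier {Ω : Set E} (hΩ : IsOpen Ω) {x y : E} (hx : x ∈ Ω)
    (hy : y ∉ Ω) : ∃ z ∈ segment ℝ x y, z ∈ frontier Ω := by
  by_contra! h
  have hsub : segment ℝ x y ⊆ Ω ∪ (closure Ω)ᶜ := fun z hz => by
    by_cases hzΩ : z ∈ Ω
    · exact Or.inl hzΩ
    · refine Or.inr fun hzc => h z hz ?_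
      rw [hΩ.frontier_eq]
      exact ⟨hzc, hzΩ⟩
  obtain ⟨z, -, hz, hz'⟩ := (convex_segment (𝕜 := ℝ) x y).isPreconnected Ω (closure Ω)ᶜ hΩ
    isClosed_closure.isOpen_compl hsub ⟨x, left_mem_segment ℝ x y, hx⟩
    ⟨y, right_mem_segment ℝ x y, (hsub (right_mem_segment ℝ x y)).resolve_left hy⟩
  exact hz' (subset_closure hz)

/-- Extending a Lipschitz function vanishing on the frontier of an open set by zero outside of it
gives a Lipschitz function. -/
theorem LipschitzWith.indicator_of_frontier {Ω : Set E} (hΩ : IsOpen Ω) {f : E → ℝ}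
    {C : NNReal} (hf : LipschitzWith C f) (h0 : ∀ x ∈ frontier Ω, f x = 0) :
    LipschitzWith C (Ω.indicator f) := by
  have key : ∀ x ∈ Ω, ∀ y ∉ Ω, |f x| ≤ C * dist x y := fun x hx y hy => by
    obtain ⟨z, hz, hzf⟩ := hΩ.exists_mem_segment_frontier hx hy
    have h1 := hf.dist_le_mul x z
    rw [h0 z hzf, Real.dist_eq, sub_zero] at h1
    refine h1.trans (mul_le_mul_of_nonneg_left ?_ C.2)
    have := dist_add_dist_of_mem_segment hz
    linarith [dist_nonneg (x := z) (y := y)]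
  refine LipschitzWith.of_dist_le_mul fun x y => ?_
  by_cases hx : x ∈ Ω <;> by_cases hy : y ∈ Ω
  · simpa [hx, hy] using hf.dist_le_mul x y
  · simpa [hx, hy, Real.dist_eq] using key x hx y hy
  · simpa [hx, hy, Real.dist_eq, dist_comm] using key y hy x hx
  · simp [hx, hy]; positivity

end Segment

section LevelSet

variable {E : Type*} [NormedAddCommGroup E] [NormedSpace ℝ E] [FiniteDimensional ℝ E]
  [MeasurableSpace E] [BorelSpace E] {μ : Measure E}

/-- The zeros of a real function at which its derivative does not vanish form a null set. -/
theorem ae_deriv_eq_zero_of_eq_zero (f : ℝ → ℝ) : ∀ᵐ s, f s = 0 → deriv f s = 0 := by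
  have hc : {s ∈ {s | f s = 0} | 𝓝[{s | f s = 0} ∩ Set.Ioi s] s = ⊥}.Countable :=
    countable_setOfPred_isolated_right_within
  filter_upwards [hc.ae_notMem volume] with s hs h0
  by_contra hd
  refine hs ⟨h0, ?_⟩
  have hne : ∀ᶠ z in 𝓝[≠] s, f z ≠ 0 :=
    (differentiableAt_of_deriv_ne_zero hd).hasDerivAt.eventually_ne hd
  rw [← Filter.empty_mem_iff_bot, mem_nhdsWithin_iff_eventually]
  rw [eventually_nhdsWithin_iff] at hne
  filter_upwards [hne] with z hz hz'
  exact hz (ne_of_gt hz'.2) hz'.1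

/-- A line derivative of a continuous function vanishes almost everywhere on the zero set. -/
theorem ae_lineDeriv_eq_zero_of_eq_zero [μ.IsAddHaarMeasure] {f : E → ℝ} (hf : Continuous f)
    (v : E) : ∀ᵐ x ∂μ, f x = 0 → lineDeriv ℝ f x v = 0 := by
  let L : ℝ →L[ℝ] E := ContinuousLinearMap.smulRight (1 : ℝ →L[ℝ] ℝ) v
  have hmeas : MeasurableSet {x | f x = 0 → lineDeriv ℝ f x v = 0} := by
    have h1 : MeasurableSet {x | f x = 0} := (isClosed_eq hf continuous_const).measurableSet
    have h2 : MeasurableSet {x | lineDeriv ℝ f x v = 0} :=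
      measurable_lineDeriv hf (measurableSet_singleton 0)
    convert h1.compl.union h2 using 1
    ext x
    simp [imp_iff_not_or]
  refine ae_mem_of_ae_add_linearMap_mem L.toLinearMap volume μ hmeas fun y => ?_
  filter_upwards [ae_deriv_eq_zero_of_eq_zero fun s => f (y + s • v)] with s hs h0
  have h := hs (by simpa [L] using h0)
  rw [lineDeriv]
  have : (fun r : ℝ => f (y + L.toLinearMap s + r • v)) = fun r => f (y + (s + r) • v) := by
    funext r
    simp [L, add_smul, add_assoc]
  rw [this, deriv_comp_const_add (f := fun s => f (y + s • v)), add_zero, h]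

/-- A directional derivative of a compactly supported `C¹` function which vanishes on the frontier
of an open set has zero integral over this set. -/
theorem setIntegral_fderiv_eq_zero_of_frontier [μ.IsAddHaarMeasure] {Ω : Set E} (hΩ : IsOpen Ω)
    {f : E → ℝ} (hf : ContDiff ℝ 1 f) (hfc : HasCompactSupport f)
    (h0 : ∀ x ∈ frontier Ω, f x = 0) (v : E) : ∫ x in Ω, fderiv ℝ f x v ∂μ = 0 := by
  obtain ⟨C, hC⟩ := hf.lipschitzWith_of_hasCompactSupport hfc one_ne_zero
  have hg := hC.indicator_of_frontier hΩ h0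
  have hgc : HasCompactSupport (Ω.indicator f) :=
    hfc.mono fun x hx hfx => hx (by simp [Set.indicator, hfx])
  have hint : ∫ x, lineDeriv ℝ (Ω.indicator f) x v ∂μ = 0 := by
    have h := LipschitzWith.integral_lineDeriv_mul_eq (μ := μ)
      (LipschitzWith.const (α := E) (1 : ℝ)) hg hgc (-v)
    have hconst : ∀ x : E, lineDeriv ℝ (fun _ : E => (1 : ℝ)) x (-v) = 0 := fun x => by
      simp [lineDeriv]
    simpa [hconst] using h.symm
  rw [← integral_indicator hΩ.measurableSet, ← hint]
  refine integral_congr_ae ?_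
  filter_upwards [ae_lineDeriv_eq_zero_of_eq_zero (μ := μ) hg.continuous v] with x hx
  by_cases hxΩ : x ∈ Ω
  · have heq : Ω.indicator f =ᶠ[𝓝 x] f := by
      filter_upwards [hΩ.mem_nhds hxΩ] with y hy
      simp [hy]
    rw [heq.lineDeriv_eq, Set.indicator_of_mem hxΩ,
      (hf.differentiable one_ne_zero x).lineDeriv_eq_fderiv]
  · rw [hx (Set.indicator_of_notMem hxΩ f), Set.indicator_of_notMem hxΩ]

end LevelSet

section Parametric

variable {E : Type*} [NormedAddCommGroup E] [NormedSpace ℝ E]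

/-- Differentiation in the first variable of a function on a product. -/
theorem fderiv_comp_prodMk_left {F : E × ℝ → ℝ} {x : E} {s : ℝ}
    (hF : DifferentiableAt ℝ F (x, s)) (v : E) :
    fderiv ℝ (fun y => F (y, s)) x v = fderiv ℝ F (x, s) (v, 0) := by
  have h : HasFDerivAt (fun y => F (y, s)) _ x :=
    hF.hasFDerivAt.comp x (hasFDerivAt_prodMk_left x s)
  rw [h.fderiv]
  simp

/-- Differentiation in the second variable of a function on a product. -/
theorem hasDerivAt_comp_prodMk_right {F : E × ℝ → ℝ} {x : E} {s : ℝ}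
    (hF : DifferentiableAt ℝ F (x, s)) :
    HasDerivAt (fun r => F (x, r)) (fderiv ℝ F (x, s) (0, 1)) s := by
  have h : HasFDerivAt (fun r => F (x, r)) _ s :=
    hF.hasFDerivAt.comp s (hasFDerivAt_prodMk_right x s)
  simpa using h.hasDerivAt

/-- Differentiation under the integral sign for a `C¹` integrand with support in a fixed compact
set. -/
theorem hasDerivAt_integral_of_contDiff_of_compact [MeasurableSpace E] [BorelSpace E]
    [FiniteDimensional ℝ E]
    {μ : Measure E} [IsFiniteMeasureOnCompacts μ] {G : E × ℝ → ℝ} (hG : ContDiff ℝ 1 G)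
    {K : Set E} (hK : IsCompact K) {t δ : ℝ} (hδ : 0 < δ)
    (h0 : ∀ x ∉ K, ∀ s ∈ Metric.ball t δ, G (x, s) = 0) :
    HasDerivAt (fun s => ∫ x, G (x, s) ∂μ) (∫ x, fderiv ℝ G (x, t) (0, 1) ∂μ) t := by
  have hcont : Continuous fun p : E × ℝ => fderiv ℝ G p (0, 1) :=
    (hG.continuous_fderiv one_ne_zero).clm_apply continuous_const
  have hGd : Differentiable ℝ G := hG.differentiable one_ne_zero
  obtain ⟨C, hC⟩ := (hK.prod (isCompact_closedBall t δ)).exists_bound_of_continuousOn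
    hcont.continuousOn
  have hzero : ∀ x ∉ K, ∀ s ∈ Metric.ball t δ, fderiv ℝ G (x, s) (0, 1) = 0 := fun x hx s hs => by
    have he : (fun r => G (x, r)) =ᶠ[𝓝 s] fun _ => 0 := by
      filter_upwards [Metric.isOpen_ball.mem_nhds hs] with r hr using h0 x hx r hr
    rw [← (hasDerivAt_comp_prodMk_right (hGd (x, s))).deriv, he.deriv_eq, deriv_const]
  refine (hasDerivAt_integral_of_dominated_loc_of_deriv_le
    (F' := fun s x => fderiv ℝ G (x, s) (0, 1)) (bound := K.indicator fun _ => C)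
    (Metric.ball_mem_nhds t hδ) (.of_forall fun s => ?_) ?_ ?_ ?_ ?_ ?_).2
  · exact (hG.continuous.comp (by fun_prop : Continuous fun x : E => (x, s))).aestronglyMeasurable
  · exact (hG.continuous.comp
      (by fun_prop : Continuous fun x : E => (x, t))).integrable_of_hasCompactSupport
      (HasCompactSupport.intro hK fun x hx => h0 x hx t (Metric.mem_ball_self hδ))
  · exact (hcont.comp (by fun_prop : Continuous fun x : E => (x, t))).aestronglyMeasurable
  · refine .of_forall fun x s hs => ?_
    by_cases hx : x ∈ K
    · rw [Set.indicator_of_mem hx]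
      exact hC (x, s) ⟨hx, Metric.ball_subset_closedBall hs⟩
    · rw [hzero x hx s hs, Set.indicator_of_notMem hx, norm_zero]
  · exact (integrable_indicator_iff hK.measurableSet).2
      (integrableOn_const hK.measure_lt_top.ne)
  · exact .of_forall fun x s _ => hasDerivAt_comp_prodMk_right (hGd (x, s))

end Parametric

/-- The inner product of two gradients in coordinates. -/
theorem EuclideanSpace.inner_gradient {N : ℕ} (f g : EuclideanSpace ℝ (Fin N) → ℝ)
    (x : EuclideanSpace ℝ (Fin N)) :
    inner ℝ (gradient f x) (gradient g x) = ∑ i, fderiv ℝ f x (EuclideanSpace.single i 1) *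
      fderiv ℝ g x (EuclideanSpace.single i 1) := by
  have h : ∀ (f : EuclideanSpace ℝ (Fin N) → ℝ) (i : Fin N),
      gradient f x i = fderiv ℝ f x (EuclideanSpace.single i 1) := fun f i => by
    have := InnerProductSpace.toDual_symm_apply (𝕜 := ℝ) (x := EuclideanSpace.single i (1 : ℝ))
      (y := fderiv ℝ f x)
    rw [← this, real_inner_comm, EuclideanSpace.inner_single_left]
    simp [gradient]
  rw [PiLp.inner_apply]
  refine Finset.sum_congr rfl fun i _ => ?_
  simp only [h]
  simp [mul_comm]

/-- A function continuous on the closure of a set and vanishing outside of a compact set is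
integrable on this set. -/
theorem integrableOn_of_continuousOn_closure {E : Type*} [NormedAddCommGroup E]
    [MeasurableSpace E] [BorelSpace E] {μ : Measure E} [IsFiniteMeasureOnCompacts μ] {Ω K : Set E}
    (hΩ : MeasurableSet Ω) (hK : IsCompact K) {f : E → ℝ} (hf : ContinuousOn f (closure Ω))
    (h0 : ∀ x ∉ K, f x = 0) : IntegrableOn f Ω μ :=
  ((hf.mono Set.inter_subset_left).integrableOn_compact
      (hK.inter_left isClosed_closure)).of_forall_sdiff_eq_zero hΩ
    fun x hx => h0 x fun hxK => hx.2 ⟨subset_closure hx.1, hxK⟩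

/-- **Lemma 3.2 (lem_en0), first assertion.** For a positive weight `Φ` with
`∂_t Φ < 0` and a smooth solution `u` of the damped wave equation on the exterior
domain `Ω`, the weighted energy `∫_Ω (|∇u|² + |u_t|²) Φ dx` is differentiable in `t`
with derivative
`∫_Ω (∂_tΦ)⁻¹ |(∂_tΦ)∇u − u_t ∇Φ|² dx
  + ∫_Ω (−2aΦ + ∂_tΦ − (∂_tΦ)⁻¹|∇Φ|²) |u_t|² dx`. -/
theorem stmt5 (N : ℕ) (hN : 2 ≤ N) (Ω : Set (EuclideanSpace ℝ (Fin N)))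
    (hΩopen : IsOpen Ω) (hΩconn : IsConnected Ω) (hΩcompl : IsCompact Ωᶜ)
    (hΩ0 : (0 : EuclideanSpace ℝ (Fin N)) ∉ closure Ω)
    (a : EuclideanSpace ℝ (Fin N) → ℝ) (ha : ContDiff ℝ 2 a) (ha_pos : ∀ x, 0 < a x)
    (a₁ a₂ α : ℝ) (ha₁ : 0 < a₁) (ha₂ : 0 < a₂) (hα : 0 ≤ α ∧ α < 1)
    (ha_bd : ∀ x : EuclideanSpace ℝ (Fin N),
      a₁ * (1 + ‖x‖) ^ (-α) ≤ a x ∧ a x ≤ a₂ * (1 + ‖x‖) ^ (-α))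
    (u : EuclideanSpace ℝ (Fin N) → ℝ → ℝ)
    (hu : ContDiff ℝ (⊤ : ℕ∞) (fun p : EuclideanSpace ℝ (Fin N) × ℝ => u p.1 p.2))
    (hpde : ∀ x ∈ Ω, ∀ s > (0 : ℝ),
      deriv (deriv (u x)) s - lap (fun y => u y s) x + a x * deriv (u x) s = 0)
    (hbdry : ∀ x ∈ frontier Ω, ∀ s > (0 : ℝ), u x s = 0)
    (R₀ : ℝ) (hR₀ : 0 < R₀)
    (hinit : ∀ x : EuclideanSpace ℝ (Fin N), R₀ ≤ ‖x‖ → u x 0 = 0 ∧ deriv (u x) 0 = 0)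
    (hfsp : ∀ s ≥ (0 : ℝ), ∀ x : EuclideanSpace ℝ (Fin N), R₀ + s < ‖x‖ → u x s = 0)
    (Φ : EuclideanSpace ℝ (Fin N) → ℝ → ℝ)
    (hΦ : ContDiff ℝ 2 (fun p : EuclideanSpace ℝ (Fin N) × ℝ => Φ p.1 p.2))
    (hΦpos : ∀ x ∈ closure Ω, ∀ s ≥ (0 : ℝ), 0 < Φ x s)
    (hΦt : ∀ x ∈ closure Ω, ∀ s ≥ (0 : ℝ), deriv (Φ x) s < 0)
    (t : ℝ) (ht : 0 < t) :
    HasDerivAt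
      (fun τ => ∫ x in Ω,
        (‖gradient (fun y => u y τ) x‖ ^ 2 + (deriv (u x) τ) ^ 2) * Φ x τ)
      ((∫ x in Ω, (deriv (Φ x) t)⁻¹ *
          ‖(deriv (Φ x) t) • gradient (fun y => u y t) x
            - (deriv (u x) t) • gradient (fun y => Φ y t) x‖ ^ 2)
        + ∫ x in Ω,
            (-2 * a x * Φ x t + deriv (Φ x) t
              - (deriv (Φ x) t)⁻¹ * ‖gradient (fun y => Φ y t) x‖ ^ 2)
              * (deriv (u x) t) ^ 2) t := by
  let e : Fin N → EuclideanSpace ℝ (Fin N) := fun i => EuclideanSpace.single i 1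
  let U : EuclideanSpace ℝ (Fin N) × ℝ → ℝ := fun p => u p.1 p.2
  let P : EuclideanSpace ℝ (Fin N) × ℝ → ℝ := fun p => Φ p.1 p.2
  let ut : EuclideanSpace ℝ (Fin N) × ℝ → ℝ := fun p => fderiv ℝ U p (0, 1)
  let ui : Fin N → EuclideanSpace ℝ (Fin N) × ℝ → ℝ := fun i p => fderiv ℝ U p (e i, 0)
  let pt : EuclideanSpace ℝ (Fin N) × ℝ → ℝ := fun p => fderiv ℝ P p (0, 1)
  let pi : Fin N → EuclideanSpace ℝ (Fin N) × ℝ → ℝ := fun i p => fderiv ℝ P p (e i, 0)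
  have hU : ContDiff ℝ (⊤ : ℕ∞) U := hu
  have hP : ContDiff ℝ 2 P := hΦ
  have hUd : Differentiable ℝ U := hU.differentiable (by simp)
  have hPd : Differentiable ℝ P := hP.differentiable two_ne_zero
  have hdU : ContDiff ℝ 1 (fderiv ℝ U) := hU.fderiv_right (by norm_cast)
  have hdP : Continuous (fderiv ℝ P) := hP.continuous_fderiv two_ne_zero
  have hut : ContDiff ℝ 1 ut := hdU.clm_apply contDiff_const
  have hui : ∀ i, ContDiff ℝ 1 (ui i) := fun i => hdU.clm_apply contDiff_const
  have hpt : Continuous pt := hdP.clm_apply continuous_const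
  have hpi : ∀ i, Continuous (pi i) := fun i => hdP.clm_apply continuous_const
  have hutd : Differentiable ℝ ut := hut.differentiable one_ne_zero
  have huid : ∀ i, Differentiable ℝ (ui i) := fun i => (hui i).differentiable one_ne_zero
  have deriv_u : ∀ x s, deriv (u x) s = ut (x, s) := fun x s =>
    (hasDerivAt_comp_prodMk_right (hUd (x, s))).deriv
  have deriv_Φ : ∀ x s, deriv (Φ x) s = pt (x, s) := fun x s =>
    (hasDerivAt_comp_prodMk_right (hPd (x, s))).deriv
  have fderiv_u : ∀ x s i, fderiv ℝ (fun y => u y s) x (EuclideanSpace.single i 1) = ui i (x, s) :=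
    fun x s i => fderiv_comp_prodMk_left (hUd (x, s)) (e i)
  have fderiv_Φ : ∀ x s i, fderiv ℝ (fun y => Φ y s) x (EuclideanSpace.single i 1) = pi i (x, s) :=
    fun x s i => fderiv_comp_prodMk_left (hPd (x, s)) (e i)
  have lap_u : ∀ x s, lap (fun y => u y s) x = ∑ i, fderiv ℝ (ui i) (x, s) (e i, 0) :=
    fun x s => by
      simp only [lap, fderiv_u]
      exact Finset.sum_congr rfl fun i _ => fderiv_comp_prodMk_left (huid i (x, s)) (e i)
  have deriv_deriv_u : ∀ x s, deriv (deriv (u x)) s = fderiv ℝ ut (x, s) (0, 1) := fun x s => by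
    rw [show deriv (u x) = fun r => ut (x, r) from funext (deriv_u x)]
    exact (hasDerivAt_comp_prodMk_right (hutd (x, s))).deriv
  have symm_u : ∀ i p, fderiv ℝ (ui i) p (0, 1) = fderiv ℝ ut p (e i, 0) := fun i p => by
    have hs : IsSymmSndFDerivAt ℝ U p :=
      (contDiff_infty.1 hU 2).contDiffAt.isSymmSndFDerivAt (by simp)
    have hd : DifferentiableAt ℝ (fderiv ℝ U) p := hdU.differentiable one_ne_zero p
    have hv : ∀ v w, fderiv ℝ (fun q => fderiv ℝ U q v) p w = fderiv ℝ (fderiv ℝ U) p w v :=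
      fun v w => by
        rw [fderiv_clm_apply hd (differentiableAt_const v)]
        simp
    rw [hv, hv, hs.eq]
  have norm_u : ∀ x s, ‖gradient (fun y => u y s) x‖ ^ 2 = ∑ i, ui i (x, s) ^ 2 := fun x s => by
    rw [← real_inner_self_eq_norm_sq, EuclideanSpace.inner_gradient]
    simp only [fderiv_u, sq]
  have norm_Φ : ∀ x s, ‖gradient (fun y => Φ y s) x‖ ^ 2 = ∑ i, pi i (x, s) ^ 2 := fun x s => by
    rw [← real_inner_self_eq_norm_sq, EuclideanSpace.inner_gradient]
    simp only [fderiv_Φ, sq]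
  have norm_sub : ∀ x s, ‖pt (x, s) • gradient (fun y => u y s) x
      - ut (x, s) • gradient (fun y => Φ y s) x‖ ^ 2 = pt (x, s) ^ 2 * ∑ i, ui i (x, s) ^ 2
        - 2 * (pt (x, s) * ut (x, s) * ∑ i, ui i (x, s) * pi i (x, s))
        + ut (x, s) ^ 2 * ∑ i, pi i (x, s) ^ 2 := fun x s => by
    rw [norm_sub_sq_real, norm_smul, norm_smul, mul_pow, mul_pow, norm_u, norm_Φ,
      real_inner_smul_left, real_inner_smul_right, EuclideanSpace.inner_gradient]
    simp only [fderiv_u, fderiv_Φ, Real.norm_eq_abs, sq_abs, mul_assoc]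
  let K : Set (EuclideanSpace ℝ (Fin N)) := Metric.closedBall 0 (R₀ + 2 * t)
  have hK : IsCompact K := isCompact_closedBall _ _
  have dU_zero : ∀ x ∉ K, ∀ s ∈ Metric.ball t t, fderiv ℝ U (x, s) = 0 := fun x hx s hs => by
    rw [Metric.mem_ball, Real.dist_eq, abs_lt] at hs
    have hx' : R₀ + 2 * t < ‖x‖ := by simpa [K] using hx
    have hopen : IsOpen {p : EuclideanSpace ℝ (Fin N) × ℝ | R₀ + p.2 < ‖p.1‖ ∧ 0 < p.2} :=
      (isOpen_lt (continuous_const.add continuous_snd) continuous_fst.norm).and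
        (isOpen_lt continuous_const continuous_snd)
    have he : U =ᶠ[𝓝 (x, s)] fun _ => 0 := by
      filter_upwards [hopen.mem_nhds (⟨by simp only; linarith, by simp only; linarith⟩ :
        R₀ + (x, s).2 < ‖(x, s).1‖ ∧ 0 < (x, s).2)] with p hp
      exact hfsp p.2 hp.2.le p.1 hp.1
    rw [he.fderiv_eq, fderiv_const_apply]
  have ut_zero : ∀ x ∉ K, ∀ s ∈ Metric.ball t t, ut (x, s) = 0 := fun x hx s hs => by
    simp [ut, dU_zero x hx s hs]
  have ui_zero : ∀ x ∉ K, ∀ s ∈ Metric.ball t t, ∀ i, ui i (x, s) = 0 := fun x hx s hs i => by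
    simp [ui, dU_zero x hx s hs]
  have htt : t ∈ Metric.ball t t := Metric.mem_ball_self ht
  have ut_frontier : ∀ x ∈ frontier Ω, ut (x, t) = 0 := fun x hx => by
    have he : u x =ᶠ[𝓝 t] fun _ => 0 := by
      filter_upwards [lt_mem_nhds ht] with s hs using hbdry x hx s hs
    rw [← deriv_u, he.deriv_eq, deriv_const]
  let G : EuclideanSpace ℝ (Fin N) × ℝ → ℝ := fun p => (∑ i, ui i p ^ 2 + ut p ^ 2) * P p
  have hG : ContDiff ℝ 1 G :=
    ((ContDiff.sum fun i _ => (hui i).pow 2).add (hut.pow 2)).mul (hP.of_le one_le_two)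
  have hderiv : HasDerivAt (fun s => ∫ x in Ω, G (x, s)) (∫ x in Ω, fderiv ℝ G (x, t) (0, 1)) t :=
    hasDerivAt_integral_of_contDiff_of_compact hG hK ht
      fun x hx s hs => by simp [G, ut_zero x hx s hs, ui_zero x hx s hs]
  have dG : ∀ x, fderiv ℝ G (x, t) (0, 1) =
      (∑ i, 2 * (ui i (x, t) * fderiv ℝ ut (x, t) (e i, 0))
        + 2 * (ut (x, t) * fderiv ℝ ut (x, t) (0, 1))) * P (x, t)
      + (∑ i, ui i (x, t) ^ 2 + ut (x, t) ^ 2) * pt (x, t) := fun x => by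
    have h1 := hasDerivAt_comp_prodMk_right (hG.differentiable one_ne_zero (x, t))
    have h2 : ∀ i ∈ Finset.univ, HasDerivAt (fun r => ui i (x, r) ^ 2)
        (2 * (ui i (x, t) * fderiv ℝ ut (x, t) (e i, 0))) t := fun i _ => by
      refine ((hasDerivAt_comp_prodMk_right (huid i (x, t))).pow 2).congr_deriv ?_
      rw [symm_u]
      push_cast
      ring
    have h3 : HasDerivAt (fun r => ut (x, r) ^ 2)
        (2 * (ut (x, t) * fderiv ℝ ut (x, t) (0, 1))) t := by
      refine ((hasDerivAt_comp_prodMk_right (hutd (x, t))).pow 2).congr_deriv ?_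
      push_cast
      ring
    exact h1.unique (((HasDerivAt.fun_sum h2).add h3).mul
      (hasDerivAt_comp_prodMk_right (hPd (x, t))))
  let f : Fin N → EuclideanSpace ℝ (Fin N) → ℝ := fun i x => P (x, t) * ut (x, t) * ui i (x, t)
  have hslice : ContDiff ℝ 1 fun x : EuclideanSpace ℝ (Fin N) => (x, t) :=
    contDiff_id.prodMk contDiff_const
  have hf : ∀ i, ContDiff ℝ 1 (f i) := fun i =>
    (((hP.of_le one_le_two).comp hslice).mul (hut.comp hslice)).mul ((hui i).comp hslice)
  have hfc : ∀ i, HasCompactSupport (f i) := fun i =>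
    HasCompactSupport.intro hK fun x hx => by simp [f, ut_zero x hx t htt]
  have hf_int : ∀ i, ∫ x in Ω, fderiv ℝ (f i) x (e i) = 0 := fun i =>
    setIntegral_fderiv_eq_zero_of_frontier hΩopen (hf i) (hfc i)
      (fun x hx => by simp [f, ut_frontier x hx]) (e i)
  have df : ∀ i x, fderiv ℝ (f i) x (e i) = pi i (x, t) * ut (x, t) * ui i (x, t)
      + P (x, t) * fderiv ℝ ut (x, t) (e i, 0) * ui i (x, t)
      + P (x, t) * ut (x, t) * fderiv ℝ (ui i) (x, t) (e i, 0) := fun i x => by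
    have h1 := fderiv_comp_prodMk_left
      (((hPd (x, t)).mul (hutd (x, t))).mul (huid i (x, t))) (e i)
    refine h1.trans ?_
    rw [fderiv_mul ((hPd (x, t)).mul (hutd (x, t))) (huid i (x, t)),
      fderiv_mul (hPd (x, t)) (hutd (x, t))]
    simp only [add_apply, smul_apply, smul_eq_mul, Pi.mul_apply, pi]
    ring
  have hc : Continuous fun x : EuclideanSpace ℝ (Fin N) => (x, t) := hslice.continuous
  have hptc : Continuous fun x => pt (x, t) := hpt.comp hc
  have hutc : Continuous fun x => ut (x, t) := hut.continuous.comp hc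
  have hPc : Continuous fun x => Φ x t := hP.continuous.comp hc
  have huic : ∀ i, Continuous fun x => ui i (x, t) := fun i => (hui i).continuous.comp hc
  have hpic : ∀ i, Continuous fun x => pi i (x, t) := fun i => (hpi i).comp hc
  have hac : Continuous a := ha.continuous
  have pt_ne : ∀ x ∈ closure Ω, pt (x, t) ≠ 0 := fun x hx => by
    rw [← deriv_Φ]
    exact (hΦt x hx t ht.le).ne
  have hinv : ContinuousOn (fun x => (pt (x, t))⁻¹) (closure Ω) := hptc.continuousOn.inv₀ pt_ne
  simp only [deriv_u, deriv_Φ, norm_u, norm_Φ, norm_sub]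
  refine hderiv.congr_deriv ?_
  rw [← integral_add]
  · have hdf_int : ∀ i ∈ Finset.univ, Integrable (fun x => fderiv ℝ (f i) x (e i))
        (volume.restrict Ω) := fun i _ =>
      ((((hf i).continuous_fderiv one_ne_zero).clm_apply
        continuous_const).integrable_of_hasCompactSupport
          ((hfc i).fderiv_apply ℝ (e i))).integrableOn
    have hdG_int : Integrable (fun x => fderiv ℝ G (x, t) (0, 1)) (volume.restrict Ω) := by
      refine integrableOn_of_continuousOn_closure hΩopen.measurableSet hK
        (((hG.continuous_fderiv one_ne_zero).comp hc).clm_apply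
          continuous_const).continuousOn fun x hx => ?_
      rw [dG]
      simp [ut_zero x hx t htt, ui_zero x hx t htt]
    have hsum : ∫ x in Ω, (fderiv ℝ G (x, t) (0, 1) - 2 * ∑ i, fderiv ℝ (f i) x (e i))
        = ∫ x in Ω, fderiv ℝ G (x, t) (0, 1) := by
      rw [integral_sub hdG_int ((integrable_finsetSum _ hdf_int).const_mul 2),
        integral_const_mul, integral_finsetSum _ hdf_int]
      simp [hf_int]
    rw [← hsum]
    refine setIntegral_congr_fun hΩopen.measurableSet fun x hx => ?_
    have hne := pt_ne x (subset_closure hx)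
    have hw := hpde x hx t ht
    rw [deriv_deriv_u, lap_u, deriv_u] at hw
    have hutt : fderiv ℝ ut (x, t) (0, 1) =
        ∑ i, fderiv ℝ (ui i) (x, t) (e i, 0) - a x * ut (x, t) := by linarith
    simp only [dG, df, hutt, Finset.sum_add_distrib, ← Finset.mul_sum]
    have e1 : ∑ i, pi i (x, t) * ut (x, t) * ui i (x, t) =
        ut (x, t) * ∑ i, ui i (x, t) * pi i (x, t) := by
      rw [Finset.mul_sum]
      exact Finset.sum_congr rfl fun i _ => by ring
    have e2 : ∑ i, P (x, t) * fderiv ℝ ut (x, t) (e i, 0) * ui i (x, t) =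
        P (x, t) * ∑ i, ui i (x, t) * fderiv ℝ ut (x, t) (e i, 0) := by
      rw [Finset.mul_sum]
      exact Finset.sum_congr rfl fun i _ => by ring
    rw [e1, e2]
    simp only [P]
    field_simp
    ring
  · refine integrableOn_of_continuousOn_closure hΩopen.measurableSet hK ?_ fun x hx => ?_
    · exact hinv.mul (Continuous.continuousOn (by fun_prop))
    · simp [ut_zero x hx t htt, ui_zero x hx t htt]
  · refine integrableOn_of_continuousOn_closure hΩopen.measurableSet hK ?_ fun x hx => ?_
    · exact ((Continuous.continuousOn (by fun_prop)).sub
        (hinv.mul (Continuous.continuousOn (by fun_prop)))).mul (hutc.pow 2).continuousOn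
    · simp [ut_zero x hx t htt]
end
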